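/- arXiv:math/0605004 — 2 statements merged into one kernel-verified Lean document; each statement's English description precedes it below -/
import Mathlib

section
/- (Khintchine's theorem, divergence case.) Let n ≥ 1 and let ψ₁, …, ψ_n : ℕ → (0,∞) be approximating functions. If Σ_{h=1}^∞ ψ₁(h)⋯ψ_n(h) = ∞, then the set S_n(ψ₁,…,ψ_n) has full n-dimensional Lebesgue measure, i.e. the complement of S_n(ψ₁,…,ψ_n) in [0,1]^n has Lebesgue measure zero. -/
open MeasureTheory

/-- Distance from `x` to the nearest integer, `‖x‖ = min_{z ∈ ℤ} |x - z|`. -/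
noncomputable def nint (x : ℝ) : ℝ := ⨅ z : ℤ, |x - (z : ℝ)|

/-- `S_n(ψ₁, …, ψ_n)`: points `x ∈ ℝⁿ` with `‖q xᵢ‖ < ψᵢ(q)` for every `i`, for
infinitely many `q ∈ ℕ`. -/
def Sn (n : ℕ) (ψ : Fin n → ℕ → ℝ) : Set (Fin n → ℝ) :=
  { x | {q : ℕ | 0 < q ∧ ∀ i, nint (q * x i) < ψ i q}.Infinite }

theorem sum_Icc_two_inv_sq_le (N : ℕ) :
    ∑ d ∈ Finset.Icc 2 N, (1 : ℝ) / (d : ℝ) ^ 2 ≤ 3 / 4 := by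
  have key : ∀ M : ℕ, ∑ d ∈ Finset.Icc 2 (M + 2), (1 : ℝ) / (d : ℝ) ^ 2 ≤ 3 / 4 - 1 / (M + 2) := by
    intro M
    induction M with
    | zero => norm_num
    | succ M ih =>
      rw [show M + 1 + 2 = (M + 2) + 1 by ring, Finset.sum_Icc_succ_top (by omega)]
      have : (1 : ℝ) / ((M + 2 + 1 : ℕ) : ℝ) ^ 2 ≤ 1 / (M + 2) - 1 / ((M : ℝ) + 3) := by
        rw [div_sub_div _ _ (by positivity) (by positivity), div_le_div_iff₀ (by positivity) (by positivity)]
        push_cast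
        nlinarith [Nat.cast_nonneg (α := ℝ) M]
      push_cast at this ⊢
      have e : (M : ℝ) + 1 + 2 = M + 3 := by ring
      rw [e]
      linarith
  calc _ ≤ ∑ d ∈ Finset.Icc 2 (N + 2), (1 : ℝ) / (d : ℝ) ^ 2 :=
        Finset.sum_le_sum_of_subset_of_nonneg (Finset.Icc_subset_Icc le_rfl (by omega))
          (fun _ _ _ => by positivity)
    _ ≤ _ := (key N).trans (by have : (0 : ℝ) ≤ 1 / (N + 2) := by positivity
                               linarith)

theorem card_filter_not_coprime_le (N : ℕ) :
    ((((Finset.Icc 1 N) ×ˢ (Finset.Icc 1 N)).filter fun p => ¬ p.1.Coprime p.2).card : ℝ)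
      ≤ 3 / 4 * (N : ℝ) ^ 2 := by
  have hsub : (((Finset.Icc 1 N) ×ˢ (Finset.Icc 1 N)).filter fun p => ¬ p.1.Coprime p.2) ⊆
      (Finset.Icc 2 N).biUnion fun d =>
        ((Finset.Ioc 0 N).filter (d ∣ ·)) ×ˢ ((Finset.Ioc 0 N).filter (d ∣ ·)) := by
    rintro ⟨a, b⟩ h
    simp only [Finset.mem_filter, Finset.mem_product, Finset.mem_Icc] at h
    obtain ⟨⟨ha, hb⟩, hc⟩ := h
    have h0 : 0 < a.gcd b := Nat.gcd_pos_of_pos_left _ (by omega)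
    have h1 : a.gcd b ≤ a := Nat.gcd_le_left _ (by omega)
    have h2 : a.gcd b ≠ 1 := hc
    simp only [Finset.mem_biUnion, Finset.mem_filter, Finset.mem_product, Finset.mem_Icc,
      Finset.mem_Ioc]
    exact ⟨a.gcd b, by omega, ⟨by omega, Nat.gcd_dvd_left _ _⟩, by omega, Nat.gcd_dvd_right _ _⟩
  calc _ ≤ (((Finset.Icc 2 N).biUnion fun d =>
        ((Finset.Ioc 0 N).filter (d ∣ ·)) ×ˢ ((Finset.Ioc 0 N).filter (d ∣ ·))).card : ℝ) := by
        exact_mod_cast Finset.card_le_card hsub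
    _ ≤ ((∑ d ∈ Finset.Icc 2 N, (N / d) * (N / d) : ℕ) : ℝ) := by
        refine Nat.cast_le.2 (Finset.card_biUnion_le.trans (le_of_eq ?_))
        refine Finset.sum_congr rfl fun d _ => ?_
        rw [Finset.card_product, Nat.Ioc_filter_dvd_card_eq_div]
    _ ≤ ∑ d ∈ Finset.Icc 2 N, (N : ℝ) ^ 2 * (1 / (d : ℝ) ^ 2) := by
        push_cast
        refine Finset.sum_le_sum fun d _ => ?_
        have : ((N / d : ℕ) : ℝ) ≤ N / d := Nat.cast_div_le
        calc _ ≤ ((N : ℝ) / d) * (N / d) := by gcongr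
          _ = _ := by ring
    _ ≤ _ := by
        rw [← Finset.mul_sum]
        nlinarith [sum_Icc_two_inv_sq_le N, sq_nonneg (N : ℝ)]

theorem sq_div_eight_le_sum_totient (N : ℕ) :
    (N : ℝ) ^ 2 / 8 ≤ ∑ q ∈ Finset.Icc 1 N, (q.totient : ℝ) := by
  classical
  set P := (Finset.Icc 1 N) ×ˢ (Finset.Icc 1 N) with hP
  have h1 := card_filter_not_coprime_le N
  have h2 := Finset.card_filter_add_card_filter_not (s := P) (fun p => p.1.Coprime p.2)
  have h3 : P.card = N * N := by simp [hP]
  let L := (Finset.Icc 1 N).sigma fun q => (Finset.Ico 1 (1 + q)).filter q.Coprime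
  have hL : L.card = ∑ q ∈ Finset.Icc 1 N, q.totient := by
    rw [Finset.card_sigma]
    exact Finset.sum_congr rfl fun q _ => Nat.filter_coprime_Ico_eq_totient q 1
  have h4 : (P.filter fun p => p.1.Coprime p.2) ⊆
      L.image (fun s => (s.1, s.2)) ∪ L.image (fun s => (s.2, s.1)) := by
    rintro ⟨a, b⟩ h
    simp only [hP, Finset.mem_filter, Finset.mem_product, Finset.mem_Icc] at h
    obtain ⟨⟨ha, hb⟩, hc⟩ := h
    simp only [L, Finset.mem_union, Finset.mem_image, Finset.mem_sigma, Finset.mem_filter,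
      Finset.mem_Ico, Finset.mem_Icc]
    rcases le_total a b with hab | hab
    · exact Or.inr ⟨⟨b, a⟩, ⟨hb, ⟨ha.1, by show a < 1 + b; omega⟩, hc.symm⟩, rfl⟩
    · exact Or.inl ⟨⟨a, b⟩, ⟨ha, ⟨hb.1, by show b < 1 + a; omega⟩, hc⟩, rfl⟩
  have h5 : (P.filter fun p => p.1.Coprime p.2).card ≤ L.card + L.card :=
    (Finset.card_le_card h4).trans ((Finset.card_union_le _ _).trans
      (add_le_add Finset.card_image_le Finset.card_image_le))
  rw [hL] at h5
  have h6 : (((P.filter fun p => p.1.Coprime p.2).card : ℕ) : ℝ) ≤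
      ∑ q ∈ Finset.Icc 1 N, (q.totient : ℝ) + ∑ q ∈ Finset.Icc 1 N, (q.totient : ℝ) := by
    exact_mod_cast h5
  have h7 : ((P.filter fun p => p.1.Coprime p.2).card : ℝ)
      + ((P.filter fun p => ¬ p.1.Coprime p.2).card : ℝ) = N * N := by
    rw [h3] at h2
    exact_mod_cast h2
  nlinarith

theorem card_close_coprime_pairs_le {q r : ℕ} (hq : 0 < q) (hr : 0 < r) (hne : q ≠ r) (δ : ℝ)
    (hδ : 0 ≤ δ) :
    ((((Finset.range q).filter q.Coprime ×ˢ (Finset.range r).filter r.Coprime).filter fun p =>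
      ‖(((p.1 : ℝ) / q - (p.2 : ℝ) / r : ℝ) : UnitAddCircle)‖ < δ).card : ℝ) ≤ 2 * (δ * q * r) := by
  classical
  set s := ((Finset.range q).filter q.Coprime ×ˢ (Finset.range r).filter r.Coprime).filter fun p =>
      ‖(((p.1 : ℝ) / q - (p.2 : ℝ) / r : ℝ) : UnitAddCircle)‖ < δ with hs
  set d := q.gcd r with hd
  have hd0 : 0 < d := Nat.gcd_pos_of_pos_left _ hq
  obtain ⟨q', hq'⟩ : d ∣ q := Nat.gcd_dvd_left _ _
  obtain ⟨r', hr'⟩ : d ∣ r := Nat.gcd_dvd_right _ _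
  have hcop : q'.Coprime r' := by
    have := Nat.coprime_div_gcd_div_gcd (m := q) (n := r) hd0
    rwa [← hd, Nat.div_eq_of_eq_mul_right hd0 hq', Nat.div_eq_of_eq_mul_right hd0 hr'] at this
  have hq'0 : 0 < q' := by
    rcases Nat.eq_zero_or_pos q' with h | h
    · simp [h] at hq'; omega
    · exact h
  have hr'0 : 0 < r' := by
    rcases Nat.eq_zero_or_pos r' with h | h
    · simp [h] at hr'; omega
    · exact h
  set K := ⌊δ * q * r / d⌋₊ with hK
  let z : ℕ × ℕ → ℤ := fun p => round ((p.1 : ℝ) / q - (p.2 : ℝ) / r)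
  let f : ℕ × ℕ → ℤ := fun p => p.1 * r' - p.2 * q' - z p * (q' * r' * d)
  let t : Finset ℤ := (Finset.Icc (-(K : ℤ)) K).erase 0
  have ht : t.card ≤ 2 * K := by
    rw [Finset.card_erase_of_mem (by simp)]
    simp
    omega
  have hst : ∀ p ∈ s, f p ∈ t := by
    rintro ⟨a, b⟩ hp
    simp only [hs, Finset.mem_filter, Finset.mem_product, Finset.mem_range] at hp
    obtain ⟨⟨⟨ha, hac⟩, hb, hbc⟩, hlt⟩ := hp
    rw [UnitAddCircle.norm_eq] at hlt
    have hqR : (0 : ℝ) < q := by exact_mod_cast hq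
    have hrR : (0 : ℝ) < r := by exact_mod_cast hr
    have hdR : (0 : ℝ) < d := by exact_mod_cast hd0
    have hf : ((f (a, b) : ℤ) : ℝ) = ((a : ℝ) / q - (b : ℝ) / r - (z (a, b) : ℝ)) * (q * r / d) := by
      have e1 : (q : ℝ) = d * q' := by exact_mod_cast hq'
      have e2 : (r : ℝ) = d * r' := by exact_mod_cast hr'
      have hq'R : (0 : ℝ) < q' := by exact_mod_cast hq'0
      have hr'R : (0 : ℝ) < r' := by exact_mod_cast hr'0
      simp only [f]
      push_cast
      rw [e1, e2]
      field_simp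
    refine Finset.mem_erase.2 ⟨?_, ?_⟩
    · intro h0
      have h1 : (a : ℤ) * r - b * q = z (a, b) * (q * r) := by
        have : ((a : ℤ) * r' - b * q' - z (a, b) * (q' * r' * d)) = 0 := h0
        rw [hq', hr']
        push_cast
        linear_combination (d : ℤ) * this
      apply hne
      apply Nat.dvd_antisymm
      · have h2 : (q : ℤ) ∣ a * r := ⟨b + z (a, b) * r, by linear_combination h1⟩
        exact hac.dvd_of_dvd_mul_left (by exact_mod_cast h2)
      · have h2 : (r : ℤ) ∣ b * q := ⟨a - z (a, b) * q, by linear_combination -h1⟩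
        exact hbc.dvd_of_dvd_mul_left (by exact_mod_cast h2)
    · have h1 : |((f (a, b) : ℤ) : ℝ)| ≤ δ * q * r / d := by
        rw [hf, abs_mul, abs_of_pos (by positivity : (0 : ℝ) < q * r / d)]
        calc _ ≤ δ * (q * r / d) := by gcongr
          _ = _ := by ring
      have h2 : (f (a, b)).natAbs ≤ K := by
        apply Nat.le_floor
        rwa [Nat.cast_natAbs, Int.cast_abs]
      rw [Finset.mem_Icc]
      omega
  have hfib : ∀ j ∈ t, (s.filter fun p => f p = j).card ≤ d := by
    intro j _
    rw [← Finset.card_range d]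
    apply Finset.card_le_card_of_injOn (fun p => p.1 / q')
    · rintro ⟨a, b⟩ hp
      simp only [hs, Finset.coe_filter, Set.mem_ofPred_eq, Finset.mem_filter, Finset.mem_product,
        Finset.mem_range] at hp
      simp only [Finset.coe_range, Set.mem_Iio]
      rw [Nat.div_lt_iff_lt_mul hq'0]
      omega
    · rintro ⟨a, b⟩ hp ⟨a', b'⟩ hp' hdiv
      simp only [hs, Finset.coe_filter, Set.mem_ofPred_eq, Finset.mem_filter, Finset.mem_product,
        Finset.mem_range] at hp hp' hdiv
      have h1 : f (a, b) = f (a', b') := hp.2.trans hp'.2.symm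
      have h2 : ((a : ℤ) * r' - b * q' - z (a, b) * (q' * r' * d)) =
        ((a' : ℤ) * r' - b' * q' - z (a', b') * (q' * r' * d)) := h1
      have haa : a = a' := by
        have hdvd : (q' : ℤ) ∣ (a' - a) * r' :=
          ⟨b' - b + (z (a', b') - z (a, b)) * (r' * d), by linear_combination -h2⟩
        have hdvd' : (q' : ℤ) ∣ a' - a :=
          (Nat.isCoprime_iff_coprime.2 hcop).dvd_of_dvd_mul_right hdvd
        have hmod : a % q' = a' % q' := (Nat.modEq_iff_dvd.2 hdvd')
        rw [← Nat.div_add_mod a q', ← Nat.div_add_mod a' q', hdiv, hmod]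
      have hbb : b = b' := by
        subst haa
        have h3 : ((b' : ℤ) - b) = (z (a, b) - z (a, b')) * r := by
          have : ((b' : ℤ) - b) * q' = (z (a, b) - z (a, b')) * r * q' := by
            rw [hr']; push_cast; linear_combination h2
          exact mul_right_cancel₀ (by exact_mod_cast hq'0.ne') this
        have hmod : b % r = b' % r := Nat.modEq_iff_dvd.2 ⟨_, by rw [h3, mul_comm]⟩
        rwa [Nat.mod_eq_of_lt hp.1.1.2.1, Nat.mod_eq_of_lt hp'.1.1.2.1] at hmod
      rw [haa, hbb]
  have hcard : s.card ≤ d * (2 * K) :=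
    (Finset.card_le_mul_card_image_of_maps_to hst d hfib).trans (Nat.mul_le_mul_left _ ht)
  have hdR : (0 : ℝ) < d := by exact_mod_cast hd0
  have hKle : (K : ℝ) ≤ δ * q * r / d := Nat.floor_le (by positivity)
  calc (s.card : ℝ) ≤ d * (2 * K) := by exact_mod_cast hcard
    _ ≤ d * (2 * (δ * q * r / d)) := by gcongr
    _ = _ := by field_simp

theorem sq_sum_measureReal_le {α ι : Type*} [MeasurableSpace α] (μ : Measure α) [IsFiniteMeasure μ]
    (F : Finset ι) (E : ι → Set α) (hE : ∀ i, MeasurableSet (E i)) :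
    (∑ i ∈ F, μ.real (E i)) ^ 2 ≤
      μ.real (⋃ i ∈ F, E i) * ∑ i ∈ F, ∑ j ∈ F, μ.real (E i ∩ E j) := by
  set U := ⋃ i ∈ F, E i with hU
  have hUm : MeasurableSet U := F.measurableSet_biUnion fun i _ => hE i
  let g : Set α → α → ℝ := fun s => s.indicator 1
  have hg : ∀ s, MeasurableSet s → Integrable (g s) μ := fun s hs =>
    (integrable_const (1 : ℝ)).indicator hs
  have hgi : ∀ s, MeasurableSet s → ∫ x, g s x ∂μ = μ.real s := fun s hs =>
    integral_indicator_one hs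
  have key : ∀ t : ℝ, 0 ≤ μ.real U * (t * t) + (-2 * ∑ i ∈ F, μ.real (E i)) * t +
      ∑ i ∈ F, ∑ j ∈ F, μ.real (E i ∩ E j) := by
    intro t
    have hpt : ∀ x, 0 ≤ g U x * (t * t) + (-2 * ∑ i ∈ F, g (E i) x) * t +
        ∑ i ∈ F, ∑ j ∈ F, g (E i ∩ E j) x := by
      intro x
      have hprod : ∑ i ∈ F, ∑ j ∈ F, g (E i ∩ E j) x = (∑ i ∈ F, g (E i) x) ^ 2 := by
        rw [sq, Finset.sum_mul_sum]
        refine Finset.sum_congr rfl fun i _ => Finset.sum_congr rfl fun j _ => ?_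
        simp only [g, Set.inter_indicator_one, Pi.mul_apply]
      rw [hprod]
      by_cases hx : x ∈ U
      · have : g U x = 1 := by simp [g, hx]
        rw [this]
        nlinarith [sq_nonneg (t - ∑ i ∈ F, g (E i) x)]
      · have h0 : ∑ i ∈ F, g (E i) x = 0 := by
          refine Finset.sum_eq_zero fun i hi => ?_
          have : x ∉ E i := fun h => hx (Set.mem_biUnion hi h)
          simp [g, this]
        have : g U x = 0 := by simp [g, hx]
        rw [this, h0]; simp
    have h1 : Integrable (fun x => ∑ i ∈ F, g (E i) x) μ :=
      integrable_finsetSum _ fun i _ => hg _ (hE i)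
    have h2 : ∀ i, Integrable (fun x => ∑ j ∈ F, g (E i ∩ E j) x) μ := fun i =>
      integrable_finsetSum _ fun j _ => hg _ ((hE i).inter (hE j))
    have h3 : Integrable (fun x => ∑ i ∈ F, ∑ j ∈ F, g (E i ∩ E j) x) μ :=
      integrable_finsetSum _ fun i _ => h2 i
    have hnn : 0 ≤ ∫ x, (g U x * (t * t) + (-2 * ∑ i ∈ F, g (E i) x) * t +
        ∑ i ∈ F, ∑ j ∈ F, g (E i ∩ E j) x) ∂μ := integral_nonneg hpt
    have h4 : Integrable (fun x => g U x * (t * t)) μ := (hg U hUm).mul_const _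
    have h5 : Integrable (fun x => (-2 * ∑ i ∈ F, g (E i) x) * t) μ :=
      (h1.const_mul _).mul_const _
    have h6 : Integrable (fun x => g U x * (t * t) + (-2 * ∑ i ∈ F, g (E i) x) * t) μ := h4.add h5
    rw [integral_add h6 h3, integral_add h4 h5,
      integral_mul_const, integral_mul_const, integral_const_mul, hgi U hUm,
      integral_finsetSum _ fun i _ => hg _ (hE i), integral_finsetSum _ fun i _ => h2 i] at hnn
    convert hnn using 2
    · congr 2
      exact congrArg _ (Finset.sum_congr rfl fun i _ => (hgi _ (hE i)).symm)
    · refine Finset.sum_congr rfl fun i _ => ?_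
      rw [integral_finsetSum _ fun j _ => hg _ ((hE i).inter (hE j))]
      exact Finset.sum_congr rfl fun j _ => (hgi _ ((hE i).inter (hE j))).symm
  have := discrim_le_zero key
  rw [discrim] at this
  nlinarith

theorem sum_mul_nonneg_of_antitone {b Ψ : ℕ → ℝ} (hΨ : Antitone Ψ) (hpos : ∀ q, 0 ≤ Ψ q)
    (hb : ∀ N, 0 ≤ ∑ q ∈ Finset.Icc 1 N, b q) (N : ℕ) :
    0 ≤ ∑ q ∈ Finset.Icc 1 N, b q * Ψ q := by
  have key : Ψ N * ∑ q ∈ Finset.Icc 1 N, b q ≤ ∑ q ∈ Finset.Icc 1 N, b q * Ψ q := by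
    induction N with
    | zero => simp
    | succ N ih =>
      rw [Finset.sum_Icc_succ_top (by omega), Finset.sum_Icc_succ_top (by omega)]
      nlinarith [mul_le_mul_of_nonneg_right (hΨ (Nat.le_succ N)) (hb N)]
  exact (mul_nonneg (hpos N) (hb N)).trans key

open Filter in
theorem le_measureReal_limsup {α : Type*} [MeasurableSpace α] (μ : Measure α) [IsFiniteMeasure μ]
    (E : ℕ → Set α) (hE : ∀ q, MeasurableSet (E q)) (c : ℝ)
    (h : ∀ M, c ≤ μ.real (⋃ q ≥ M, E q)) :
    c ≤ μ.real {x | ∃ᶠ q in atTop, x ∈ E q} := by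
  have hset : {x | ∃ᶠ q in atTop, x ∈ E q} = ⋂ M, ⋃ q ≥ M, E q := by
    ext x
    simp [frequently_atTop]
  rw [hset]
  have ht := tendsto_measure_iInter_atTop (μ := μ) (s := fun M => ⋃ q ≥ M, E q)
    (fun M => (MeasurableSet.biUnion (Set.to_countable _) fun q _ => hE q).nullMeasurableSet)
    (fun M M' hM => Set.biUnion_subset_biUnion_left fun q (hq : M' ≤ q) => hM.trans hq)
    ⟨0, measure_ne_top _ _⟩
  have ht' := (ENNReal.tendsto_toReal (measure_ne_top μ _)).comp ht
  exact ge_of_tendsto' ht' h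

/-- **Quasi-independent Borel–Cantelli lemma**: the limsup set has measure bounded below by a constant
depending only on the constants of quasi-independence. -/
theorem borelCantelli_quasi {α : Type*} [MeasurableSpace α] (μ : Measure α) [IsProbabilityMeasure μ]
    (E : ℕ → Set α) (hE : ∀ q, MeasurableSet (E q)) (Ψ : ℕ → ℝ) (hpos : ∀ q, 0 ≤ Ψ q)
    (hsum : ¬ Summable Ψ) {c C : ℝ} (hc : 0 < c) (hC : 0 < C)
    (hlow : ∀ N, c * ∑ q ∈ Finset.Icc 1 N, Ψ q ≤ ∑ q ∈ Finset.Icc 1 N, μ.real (E q))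
    (hdiag : ∀ q, 0 < q → μ.real (E q) ≤ C * Ψ q)
    (hover : ∀ q r, 0 < q → 0 < r → q ≠ r → μ.real (E q ∩ E r) ≤ C * (Ψ q * Ψ r)) :
    c ^ 2 / (8 * C) ≤ μ.real {x | ∃ᶠ q in Filter.atTop, x ∈ E q} := by
  apply le_measureReal_limsup μ E hE
  intro M
  have htend : Filter.Tendsto (fun N => ∑ q ∈ Finset.range N, Ψ q) Filter.atTop Filter.atTop :=
    (not_summable_iff_tendsto_nat_atTop_of_nonneg hpos).1 hsum
  set T : ℕ → ℝ := fun N => ∑ q ∈ Finset.Icc 1 N, Ψ q with hT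
  obtain ⟨N, hN1, hN2⟩ : ∃ N, 1 ≤ T N ∧ 2 * M ≤ c * T N := by
    obtain ⟨N, hN⟩ := (htend.eventually_ge_atTop (Ψ 0 + 1 + 2 * M / c)).exists
    have hle : ∑ q ∈ Finset.range N, Ψ q ≤ Ψ 0 + T N := by
      have : Finset.range N ⊆ insert 0 (Finset.Icc 1 N) := by
        intro x hx
        simp only [Finset.mem_range, Finset.mem_insert, Finset.mem_Icc] at *
        omega
      calc _ ≤ ∑ q ∈ insert 0 (Finset.Icc 1 N), Ψ q :=
            Finset.sum_le_sum_of_subset_of_nonneg this fun q _ _ => hpos q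
        _ = _ := by rw [Finset.sum_insert (by simp)]
    have h1 : 1 + 2 * M / c ≤ T N := by linarith
    have h2 : 0 ≤ 2 * M / c := by positivity
    refine ⟨N, by linarith, ?_⟩
    have h3 : 2 * M / c ≤ T N := by linarith
    rwa [div_le_iff₀ hc, mul_comm (T N)] at h3
  set F := Finset.Icc M N \ {0} with hF
  have hF0 : ∀ q ∈ F, 0 < q := by
    intro q hq
    simp [hF] at hq
    omega
  have hFsub : F ⊆ Finset.Icc 1 N := by
    intro q hq
    have := hF0 q hq
    simp [hF] at hq ⊢
    omega
  have hTF : ∑ q ∈ F, Ψ q ≤ T N :=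
    Finset.sum_le_sum_of_subset_of_nonneg hFsub fun q _ _ => hpos q
  have hTF0 : 0 ≤ ∑ q ∈ F, Ψ q := Finset.sum_nonneg fun q _ => hpos q
  have hS : c / 2 * T N ≤ ∑ q ∈ F, μ.real (E q) := by
    have hsub : Finset.Icc 1 N ⊆ F ∪ Finset.range M := by
      intro q hq
      simp [hF] at hq ⊢
      omega
    have h1 : ∑ q ∈ Finset.Icc 1 N, μ.real (E q) ≤
        ∑ q ∈ F, μ.real (E q) + ∑ q ∈ Finset.range M, μ.real (E q) := by
      refine (Finset.sum_le_sum_of_subset_of_nonneg hsub fun q _ _ => measureReal_nonneg).trans ?_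
      rw [← Finset.sum_union_inter]
      exact le_add_of_nonneg_right (Finset.sum_nonneg fun q _ => measureReal_nonneg)
    have h2 : ∑ q ∈ Finset.range M, μ.real (E q) ≤ M := by
      calc _ ≤ ∑ q ∈ Finset.range M, (1 : ℝ) := Finset.sum_le_sum fun q _ => measureReal_le_one
        _ = M := by simp
    have h3 := hlow N
    change c * T N ≤ _ at h3
    linarith
  have hQ : ∑ q ∈ F, ∑ r ∈ F, μ.real (E q ∩ E r) ≤ 2 * C * T N ^ 2 := by
    have h1 : ∀ q ∈ F, ∑ r ∈ F, μ.real (E q ∩ E r) ≤ C * Ψ q * T N + C * Ψ q := by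
      intro q hq
      rw [← Finset.add_sum_erase F _ hq, add_comm]
      apply add_le_add
      · calc _ ≤ ∑ r ∈ F.erase q, C * Ψ q * Ψ r := by
              refine Finset.sum_le_sum fun r hr => ?_
              rw [Finset.mem_erase] at hr
              rw [mul_assoc]
              exact hover q r (hF0 q hq) (hF0 r hr.2) hr.1.symm
          _ = C * Ψ q * ∑ r ∈ F.erase q, Ψ r := by rw [Finset.mul_sum]
          _ ≤ _ := by
              have := hpos q
              have h2 : ∑ r ∈ F.erase q, Ψ r ≤ T N :=
                (Finset.sum_le_sum_of_subset_of_nonneg (Finset.erase_subset _ _)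
                  fun q _ _ => hpos q).trans hTF
              gcongr
      · rw [Set.inter_self]
        exact hdiag q (hF0 q hq)
    calc _ ≤ ∑ q ∈ F, (C * Ψ q * T N + C * Ψ q) := Finset.sum_le_sum h1
      _ = (∑ q ∈ F, Ψ q) * (C * (T N + 1)) := by
          rw [Finset.sum_mul]
          exact Finset.sum_congr rfl fun q _ => by ring
      _ ≤ T N * (C * (T N + T N)) := by gcongr
      _ = _ := by ring
  have hCS := sq_sum_measureReal_le μ F E hE
  have hmono : μ.real (⋃ q ∈ F, E q) ≤ μ.real (⋃ q ≥ M, E q) := by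
    apply measureReal_mono _ (measure_ne_top _ _)
    apply Set.biUnion_subset_biUnion_left
    intro q hq
    have hq : q ∈ F := hq
    simp [hF] at hq
    exact hq.1.1
  refine le_trans ?_ hmono
  set m := μ.real (⋃ q ∈ F, E q)
  have hm : 0 ≤ m := measureReal_nonneg
  have hTpos : 0 < T N ^ 2 := by positivity
  have h1 : (c / 2 * T N) ^ 2 ≤ m * (2 * C * T N ^ 2) :=
    calc _ ≤ (∑ q ∈ F, μ.real (E q)) ^ 2 := by
          have : 0 ≤ c / 2 * T N := by positivity
          gcongr
      _ ≤ _ := hCS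
      _ ≤ _ := by gcongr
  rw [div_le_iff₀ (by positivity)]
  have h2 : T N ^ 2 * c ^ 2 ≤ T N ^ 2 * (m * (8 * C)) := by nlinarith
  exact le_of_mul_le_mul_left h2 hTpos

/-- The points of the circle within `ε / q` of a reduced fraction with denominator `q`. -/
def nearReduced (q : ℕ) (ε : ℝ) : Set UnitAddCircle :=
  ⋃ a ∈ (Finset.range q).filter q.Coprime,
    Metric.ball (((a : ℝ) / q : ℝ) : UnitAddCircle) (ε / q)

theorem measurableSet_nearReduced (q : ℕ) (ε : ℝ) : MeasurableSet (nearReduced q ε) :=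
  Finset.measurableSet_biUnion _ fun _ _ => Metric.isOpen_ball.measurableSet

theorem norm_nsmul_lt_of_mem_nearReduced {q : ℕ} (hq : 0 < q) {ε : ℝ} {y : UnitAddCircle}
    (hy : y ∈ nearReduced q ε) : ‖q • y‖ < ε := by
  simp only [nearReduced, Set.mem_iUnion, Metric.mem_ball, dist_eq_norm] at hy
  obtain ⟨a, -, ha⟩ := hy
  have hqR : (0 : ℝ) < q := by exact_mod_cast hq
  have h0 : q • ((((a : ℝ) / q : ℝ)) : UnitAddCircle) = 0 := by
    rw [← AddCircle.coe_nsmul, nsmul_eq_mul, mul_div_cancel₀ _ hqR.ne', AddCircle.coe_eq_zero_iff]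
    exact ⟨a, by simp⟩
  have h1 : q • y = q • (y - (((a : ℝ) / q : ℝ) : UnitAddCircle)) := by
    rw [smul_sub, h0, sub_zero]
  rw [h1]
  calc _ ≤ q * ‖y - (((a : ℝ) / q : ℝ) : UnitAddCircle)‖ := norm_nsmul_le
    _ < q * (ε / q) := by gcongr
    _ = ε := by field_simp

theorem UnitAddCircle.measureReal_ball_le (x : UnitAddCircle) {δ : ℝ} (hδ : 0 ≤ δ) :
    volume.real (Metric.ball x δ) ≤ 2 * δ := by
  rw [Measure.real, ← measure_congr AddCircle.closedBall_ae_eq_ball, AddCircle.volume_closedBall,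
    ENNReal.toReal_ofReal (by positivity)]
  exact min_le_right _ _

theorem UnitAddCircle.measureReal_ball (x : UnitAddCircle) {δ : ℝ} (hδ : 0 ≤ δ) (h : 2 * δ ≤ 1) :
    volume.real (Metric.ball x δ) = 2 * δ := by
  rw [Measure.real, ← measure_congr AddCircle.closedBall_ae_eq_ball, AddCircle.volume_closedBall,
    ENNReal.toReal_ofReal (by positivity), min_eq_right h]

theorem measureReal_nearReduced_le {q : ℕ} (hq : 0 < q) {ε : ℝ} (hε : 0 ≤ ε) :
    volume.real (nearReduced q ε) ≤ 2 * ε := by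
  have hqR : (0 : ℝ) < q := by exact_mod_cast hq
  calc _ ≤ ∑ a ∈ (Finset.range q).filter q.Coprime, volume.real
        (Metric.ball (((a : ℝ) / q : ℝ) : UnitAddCircle) (ε / q)) :=
        measureReal_biUnion_finset_le _ _
    _ ≤ ∑ a ∈ (Finset.range q).filter q.Coprime, 2 * (ε / q) :=
        Finset.sum_le_sum fun a _ => UnitAddCircle.measureReal_ball_le _ (by positivity)
    _ ≤ ∑ a ∈ Finset.range q, 2 * (ε / q) :=
        Finset.sum_le_sum_of_subset_of_nonneg (Finset.filter_subset _ _)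
          fun _ _ _ => by positivity
    _ = 2 * ε := by
        simp only [Finset.sum_const, Finset.card_range, nsmul_eq_mul]
        field_simp

theorem UnitAddCircle.inv_le_norm_div_sub_div {q a b : ℕ} (ha : a < q) (hb : b < q) (hab : a ≠ b) :
    1 / (q : ℝ) ≤ ‖(((a : ℝ) / q - (b : ℝ) / q : ℝ) : UnitAddCircle)‖ := by
  have hqR : (0 : ℝ) < q := by exact_mod_cast (by omega : 0 < q)
  rw [UnitAddCircle.norm_eq]
  set z := round ((a : ℝ) / q - (b : ℝ) / q)
  have h : (a : ℤ) - b - z * q ≠ 0 := by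
    intro h
    have hdvd : (q : ℤ) ∣ a - b := ⟨z, by linear_combination h⟩
    have := Int.eq_zero_of_abs_lt_dvd hdvd (by rw [abs_lt]; omega)
    omega
  have h1 : (1 : ℝ) ≤ |(a : ℝ) - b - z * q| := by exact_mod_cast Int.one_le_abs h
  have h2 : (a : ℝ) / q - (b : ℝ) / q - z = ((a : ℝ) - b - z * q) / q := by field_simp
  rw [h2, abs_div, abs_of_pos hqR]
  gcongr

theorem measureReal_nearReduced {q : ℕ} (hq : 0 < q) {ε : ℝ} (hε : 0 ≤ ε) (h : ε ≤ 1 / 2) :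
    volume.real (nearReduced q ε) = 2 * ε * (q.totient / q) := by
  have hqR : (1 : ℝ) ≤ q := by exact_mod_cast hq
  rw [nearReduced, measureReal_biUnion_finset]
  · have : ∀ a ∈ (Finset.range q).filter q.Coprime, volume.real
        (Metric.ball (((a : ℝ) / q : ℝ) : UnitAddCircle) (ε / q)) = 2 * (ε / q) := by
      intro a _
      apply UnitAddCircle.measureReal_ball _ (by positivity)
      have : ε / q ≤ ε := div_le_self hε hqR
      linarith
    rw [Finset.sum_congr rfl this, Finset.sum_const, nsmul_eq_mul]
    change (q.totient : ℝ) * _ = _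
    ring
  · intro a ha b hb hab
    simp only [Finset.coe_filter, Finset.mem_range, Set.mem_ofPred_eq] at ha hb
    apply Metric.ball_disjoint_ball
    rw [dist_eq_norm, ← AddCircle.coe_sub]
    refine le_trans ?_ (UnitAddCircle.inv_le_norm_div_sub_div ha.1 hb.1 hab)
    rw [← add_div]
    gcongr
    linarith
  · exact fun _ _ => Metric.isOpen_ball.measurableSet

theorem measureReal_nearReduced_inter_le {q r : ℕ} (hq : 0 < q) (hr : 0 < r) (hne : q ≠ r)
    {ε η : ℝ} (hε : 0 ≤ ε) (hη : 0 ≤ η) :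
    volume.real (nearReduced q ε ∩ nearReduced r η) ≤ 8 * (ε * η) := by
  have hqR : (0 : ℝ) < q := by exact_mod_cast hq
  have hrR : (0 : ℝ) < r := by exact_mod_cast hr
  set P := ((Finset.range q).filter q.Coprime ×ˢ (Finset.range r).filter r.Coprime).filter fun p =>
      ‖(((p.1 : ℝ) / q - (p.2 : ℝ) / r : ℝ) : UnitAddCircle)‖ < ε / q + η / r with hP
  have hsub : nearReduced q ε ∩ nearReduced r η ⊆ ⋃ p ∈ P,
      (Metric.ball (((p.1 : ℝ) / q : ℝ) : UnitAddCircle) (ε / q) ∩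
        Metric.ball (((p.2 : ℝ) / r : ℝ) : UnitAddCircle) (η / r)) := by
    rintro y ⟨h1, h2⟩
    simp only [nearReduced, Set.mem_iUnion] at h1 h2
    obtain ⟨a, ha, h1⟩ := h1
    obtain ⟨b, hb, h2⟩ := h2
    refine Set.mem_biUnion (x := (a, b)) ?_ ⟨h1, h2⟩
    refine Finset.mem_filter.2 ⟨Finset.mk_mem_product ha hb, ?_⟩
    rw [AddCircle.coe_sub, ← dist_eq_norm]
    rw [Metric.mem_ball'] at h1
    rw [Metric.mem_ball] at h2
    exact (dist_triangle _ y _).trans_lt (add_lt_add h1 h2)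
  have hball : ∀ p ∈ P, volume.real
      (Metric.ball (((p.1 : ℝ) / q : ℝ) : UnitAddCircle) (ε / q) ∩
        Metric.ball (((p.2 : ℝ) / r : ℝ) : UnitAddCircle) (η / r)) ≤ 2 * min (ε / q) (η / r) := by
    intro p _
    rw [mul_min_of_nonneg _ _ zero_le_two]
    exact le_min
      ((measureReal_mono Set.inter_subset_left).trans
        (UnitAddCircle.measureReal_ball_le _ (by positivity)))
      ((measureReal_mono Set.inter_subset_right).trans
        (UnitAddCircle.measureReal_ball_le _ (by positivity)))
  have hcard : (P.card : ℝ) ≤ 2 * ((ε / q + η / r) * q * r) :=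
    card_close_coprime_pairs_le hq hr hne _ (by positivity)
  have hmin : (ε / q + η / r) * min (ε / q) (η / r) ≤ 2 * (ε / q * (η / r)) := by
    have h1 : 0 ≤ ε / q := by positivity
    have h2 : 0 ≤ η / r := by positivity
    rcases le_total (ε / q) (η / r) with h | h
    · rw [min_eq_left h]; nlinarith
    · rw [min_eq_right h]; nlinarith
  have hmin0 : 0 ≤ min (ε / q) (η / r) := by positivity
  calc _ ≤ volume.real (⋃ p ∈ P, (Metric.ball (((p.1 : ℝ) / q : ℝ) : UnitAddCircle) (ε / q) ∩
        Metric.ball (((p.2 : ℝ) / r : ℝ) : UnitAddCircle) (η / r))) := measureReal_mono hsub (measure_ne_top _ _)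
    _ ≤ ∑ p ∈ P, 2 * min (ε / q) (η / r) :=
        (measureReal_biUnion_finset_le _ _).trans (Finset.sum_le_sum hball)
    _ = P.card * (2 * min (ε / q) (η / r)) := by rw [Finset.sum_const, nsmul_eq_mul]
    _ ≤ 2 * ((ε / q + η / r) * q * r) * (2 * min (ε / q) (η / r)) := by gcongr
    _ = 4 * (q * r) * ((ε / q + η / r) * min (ε / q) (η / r)) := by ring
    _ ≤ 4 * (q * r) * (2 * (ε / q * (η / r))) := by gcongr
    _ = _ := by field_simp; ring

theorem measureReal_univ_pi {ι : Type*} [Fintype ι] (s : ι → Set UnitAddCircle) :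
    (volume : Measure (ι → UnitAddCircle)).real (Set.univ.pi s) = ∏ i, volume.real (s i) := by
  simp only [Measure.real, volume_pi_pi, ENNReal.toReal_prod]

instance UnitAddCircle.isProbabilityMeasure_volume :
    IsProbabilityMeasure (volume : Measure UnitAddCircle) :=
  ⟨UnitAddCircle.measure_univ⟩

theorem sum_totient_div_pow_ge {n : ℕ} (hn : 1 ≤ n) (N : ℕ) :
    (N : ℝ) * (1 / 8) ^ n ≤ ∑ q ∈ Finset.Icc 1 N, ((q.totient : ℝ) / q) ^ n := by
  obtain ⟨k, rfl⟩ : ∃ k, n = k + 1 := ⟨n - 1, by omega⟩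
  rcases Nat.eq_zero_or_pos N with rfl | hN
  · simp
  have hNR : (0 : ℝ) < N := by exact_mod_cast hN
  have h1 : (N : ℝ) / 8 ≤ ∑ q ∈ Finset.Icc 1 N, (q.totient : ℝ) / q := by
    calc (N : ℝ) / 8 = ((N : ℝ) ^ 2 / 8) / N := by field_simp
      _ ≤ (∑ q ∈ Finset.Icc 1 N, (q.totient : ℝ)) / N := by
          gcongr
          exact sq_div_eight_le_sum_totient N
      _ ≤ _ := by
          rw [Finset.sum_div]
          refine Finset.sum_le_sum fun q hq => ?_
          rw [Finset.mem_Icc] at hq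
          have : (0 : ℝ) < q := by exact_mod_cast hq.1
          gcongr
          exact hq.2
  have h2 := pow_sum_div_card_le_sum_pow (s := Finset.Icc 1 N)
    (f := fun q : ℕ => (q.totient : ℝ) / q) (fun q _ => by positivity) k
  refine le_trans ?_ h2
  rw [Nat.card_Icc, Nat.add_sub_cancel, le_div_iff₀ (by positivity)]
  calc (N : ℝ) * (1 / 8) ^ (k + 1) * N ^ k = (N / 8) ^ (k + 1) := by
        rw [div_pow, div_pow]; ring
    _ ≤ _ := by gcongr

theorem le_measureReal_limsup_nearReduced {n : ℕ} (hn : 1 ≤ n) (ψ : Fin n → ℕ → ℝ)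
    (hpos : ∀ i q, 0 < ψ i q) (hdec : ∀ i, Antitone (ψ i)) (hhalf : ∀ i q, ψ i q ≤ 1 / 2)
    (hsum : ¬ Summable (fun h : ℕ => ∏ i, ψ i h)) :
    (((1 : ℝ) / 4) ^ n) ^ 2 / (8 * 8 ^ n) ≤ (volume : Measure (Fin n → UnitAddCircle)).real
      {y | ∃ᶠ q in Filter.atTop, y ∈ Set.univ.pi fun i => nearReduced q (ψ i q)} := by
  have hΨpos : ∀ q, 0 < ∏ i, ψ i q := fun q => Finset.prod_pos fun i _ => hpos i q
  have hΨ : Antitone fun q => ∏ i, ψ i q := fun q r hqr =>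
    Finset.prod_le_prod (fun i _ => (hpos i r).le) fun i _ => hdec i hqr
  have hmeas : ∀ q, 0 < q → (volume : Measure (Fin n → UnitAddCircle)).real
      (Set.univ.pi fun i => nearReduced q (ψ i q)) =
        2 ^ n * ((q.totient : ℝ) / q) ^ n * ∏ i, ψ i q := by
    intro q hq
    rw [measureReal_univ_pi]
    simp_rw [fun i => measureReal_nearReduced hq (hpos i q).le (hhalf i q)]
    simp only [Finset.prod_mul_distrib, Finset.prod_const, Finset.card_univ, Fintype.card_fin]
    ring
  refine borelCantelli_quasi volume _
    (fun q => MeasurableSet.univ_pi fun i => measurableSet_nearReduced _ _)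
    (fun q => ∏ i, ψ i q) (fun q => (hΨpos q).le) hsum (by positivity) (by positivity) ?_ ?_ ?_
  · intro N
    have key := sum_mul_nonneg_of_antitone
      (b := fun q => 2 ^ n * ((q.totient : ℝ) / q) ^ n - (1 / 4) ^ n) hΨ
      (fun q => (hΨpos q).le) (fun N => by
        rw [Finset.sum_sub_distrib, ← Finset.mul_sum, Finset.sum_const, Nat.card_Icc,
          Nat.add_sub_cancel, nsmul_eq_mul, sub_nonneg]
        calc (N : ℝ) * (1 / 4) ^ n = 2 ^ n * (N * (1 / 8) ^ n) := by
              rw [show (1 / 4 : ℝ) = 2 * (1 / 8) by norm_num, mul_pow]; ring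
          _ ≤ _ := by gcongr; exact sum_totient_div_pow_ge hn N) N
    simp only [sub_mul] at key
    rw [Finset.sum_sub_distrib, ← Finset.mul_sum, sub_nonneg] at key
    refine key.trans (le_of_eq (Finset.sum_congr rfl fun q hq => ?_))
    rw [hmeas q (Finset.mem_Icc.1 hq).1]
  · intro q hq
    rw [measureReal_univ_pi]
    calc _ ≤ ∏ i : Fin n, 8 * ψ i q := Finset.prod_le_prod (fun _ _ => measureReal_nonneg)
          fun i _ => (measureReal_nearReduced_le hq (hpos i q).le).trans
            (by linarith [hpos i q])
      _ = _ := by simp [Finset.prod_mul_distrib]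
  · intro q r hq hr hne
    rw [← Set.pi_inter_distrib, measureReal_univ_pi]
    calc _ ≤ ∏ i : Fin n, 8 * (ψ i q * ψ i r) :=
          Finset.prod_le_prod (fun _ _ => measureReal_nonneg)
            fun i _ => measureReal_nearReduced_inter_le hq hr hne (hpos i q).le (hpos i r).le
      _ = _ := by simp [Finset.prod_mul_distrib]

open Filter Topology in
theorem ergodic_two_nsmul_torus (n : ℕ) :
    Ergodic (fun y : Fin n → UnitAddCircle => 2 • y) volume := by
  refine AddMonoidHom.ergodic_of_dense_iUnion_preimage_zero (μ := volume)
    (nsmulAddMonoidHom 2 : (Fin n → UnitAddCircle) →+ _) ?_ (continuous_nsmul 2) ?_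
  · intro y
    have hy : ∀ i, ∃ x ∈ Set.Ico (0 : ℝ) 1, (x : UnitAddCircle) = y i :=
      fun i => AddCircle.eq_coe_Ico (y i)
    choose x hx hxy using hy
    have ht : Tendsto (fun k : ℕ => fun i =>
        (((⌊x i * 2 ^ k⌋₊ : ℝ) / 2 ^ k : ℝ) : UnitAddCircle)) atTop (𝓝 y) := by
      refine tendsto_pi_nhds.2 fun i => ?_
      rw [← hxy i]
      refine ((AddCircle.continuous_mk' (1 : ℝ)).tendsto (x i)).comp ?_
      exact (tendsto_nat_floor_mul_div_atTop (hx i).1).comp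
        (tendsto_pow_atTop_atTop_of_one_lt one_lt_two)
    refine mem_closure_of_tendsto ht (Eventually.of_forall fun k => Set.mem_iUnion.2 ⟨k, ?_⟩)
    change (fun y : Fin n → UnitAddCircle => 2 • y)^[k] _ = 0
    rw [smul_iterate]
    funext i
    simp only [Pi.smul_apply, Pi.zero_apply]
    rw [← AddCircle.coe_nsmul, AddCircle.coe_eq_zero_iff]
    refine ⟨⌊x i * 2 ^ k⌋₊, ?_⟩
    simp only [nsmul_eq_mul, zsmul_eq_mul]
    push_cast
    field_simp
  · intro y
    choose x hx using fun i => QuotientAddGroup.mk_surjective (y i)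
    refine ⟨fun i => ((x i / 2 : ℝ) : UnitAddCircle), funext fun i => ?_⟩
    change 2 • ((x i / 2 : ℝ) : UnitAddCircle) = y i
    rw [← AddCircle.coe_nsmul, ← hx i]
    simp only [nsmul_eq_mul]
    push_cast
    rw [mul_div_cancel₀ _ two_ne_zero]

theorem measurableSet_frequently_atTop {α : Type*} [MeasurableSpace α] {E : ℕ → Set α}
    (hE : ∀ q, MeasurableSet (E q)) : MeasurableSet {x | ∃ᶠ q in Filter.atTop, x ∈ E q} := by
  have hset : {x | ∃ᶠ q in Filter.atTop, x ∈ E q} = ⋂ M, ⋃ q ≥ M, E q := by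
    ext x
    simp [Filter.frequently_atTop]
  rw [hset]
  exact MeasurableSet.iInter fun M => MeasurableSet.biUnion (Set.to_countable _) fun q _ => hE q

/-- The torus points approximable infinitely often to within `ψ i q / (m + 1)`. -/
def torusApprox {n : ℕ} (ψ : Fin n → ℕ → ℝ) (m : ℕ) : Set (Fin n → UnitAddCircle) :=
  {y | ∃ᶠ q in Filter.atTop, y ∈ {y : Fin n → UnitAddCircle | ∀ i, ‖q • y i‖ < ψ i q / (m + 1)}}

theorem measurableSet_torusApprox {n : ℕ} (ψ : Fin n → ℕ → ℝ) (m : ℕ) :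
    MeasurableSet (torusApprox ψ m) := by
  refine measurableSet_frequently_atTop fun q => ?_
  rw [Set.ofPred_forall]
  refine MeasurableSet.iInter fun i => IsOpen.measurableSet ?_
  exact isOpen_lt (by fun_prop) continuous_const

theorem antitone_torusApprox {n : ℕ} {ψ : Fin n → ℕ → ℝ} (hpos : ∀ i q, 0 < ψ i q) :
    Antitone (torusApprox ψ) := by
  intro m m' hm y hy
  refine Filter.Frequently.mono hy fun q hq i => (hq i).trans_le ?_
  have := (hpos i q).le
  gcongr

theorem two_nsmul_mem_torusApprox {n : ℕ} {ψ : Fin n → ℕ → ℝ} {m : ℕ} {y : Fin n → UnitAddCircle}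
    (hy : y ∈ torusApprox ψ (2 * m + 1)) : 2 • y ∈ torusApprox ψ m := by
  refine Filter.Frequently.mono hy fun q hq i => ?_
  have h1 := hq i
  rw [Pi.smul_apply, smul_comm]
  calc ‖2 • q • y i‖ ≤ (2 : ℕ) * ‖q • y i‖ := norm_nsmul_le
    _ < (2 : ℕ) * (ψ i q / ((2 * m + 1 : ℕ) + 1)) := by gcongr
    _ = _ := by push_cast; field_simp; ring

theorem le_measureReal_torusApprox {n : ℕ} (hn : 1 ≤ n) (ψ : Fin n → ℕ → ℝ)
    (hpos : ∀ i q, 0 < ψ i q) (hdec : ∀ i, Antitone (ψ i))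
    (hsum : ¬ Summable (fun h : ℕ => ∏ i, ψ i h)) {m : ℕ} (hm : ∀ i, 2 * ψ i 0 ≤ m) :
    (((1 : ℝ) / 4) ^ n) ^ 2 / (8 * 8 ^ n) ≤ volume.real (torusApprox ψ m) := by
  have hm0 : (0 : ℝ) < m + 1 := by positivity
  refine (le_measureReal_limsup_nearReduced hn (fun i q => ψ i q / (m + 1))
    (fun i q => div_pos (hpos i q) hm0) (fun i q r hqr => ?_) (fun i q => ?_) ?_).trans ?_
  · have := hdec i hqr
    change ψ i r / (m + 1) ≤ ψ i q / (m + 1)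
    gcongr
  · rw [div_le_iff₀ hm0]
    linarith [hm i, hdec i (Nat.zero_le q)]
  · simp only [Finset.prod_div_distrib, Finset.prod_const]
    rw [summable_div_const_iff (by positivity)]
    exact hsum
  · refine measureReal_mono (fun y hy => ?_) (measure_ne_top _ _)
    refine (Filter.Frequently.and_eventually hy (Filter.eventually_gt_atTop 0)).mono ?_
    rintro q ⟨hq, hq0⟩ i
    exact norm_nsmul_lt_of_mem_nearReduced hq0 (hq i trivial)

open Filter in
theorem ae_mem_torusApprox_zero {n : ℕ} (hn : 1 ≤ n) (ψ : Fin n → ℕ → ℝ)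
    (hpos : ∀ i q, 0 < ψ i q) (hdec : ∀ i, Antitone (ψ i))
    (hsum : ¬ Summable (fun h : ℕ => ∏ i, ψ i h)) :
    ∀ᵐ y : Fin n → UnitAddCircle, y ∈ torusApprox ψ 0 := by
  set W := ⋂ m, torusApprox ψ m with hW
  have hWm : MeasurableSet W := MeasurableSet.iInter fun m => measurableSet_torusApprox ψ m
  have hpw : 0 < volume.real W := by
    have ht := (ENNReal.tendsto_toReal (measure_ne_top volume _)).comp
      (tendsto_measure_iInter_atTop (μ := volume) (s := torusApprox ψ)
      (fun m => (measurableSet_torusApprox ψ m).nullMeasurableSet)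
      (antitone_torusApprox hpos) ⟨0, measure_ne_top _ _⟩)
    obtain ⟨M, hM⟩ := exists_nat_ge (∑ i, 2 * ψ i 0)
    have hc : (0 : ℝ) < (((1 : ℝ) / 4) ^ n) ^ 2 / (8 * 8 ^ n) := by positivity
    refine hc.trans_le (ge_of_tendsto ht ((eventually_ge_atTop M).mono fun m hm => ?_))
    refine le_measureReal_torusApprox hn ψ hpos hdec hsum fun i => ?_
    calc 2 * ψ i 0 ≤ ∑ i, 2 * ψ i 0 := Finset.single_le_sum (f := fun i => 2 * ψ i 0)
          (fun j _ => mul_nonneg zero_le_two (hpos j 0).le) (Finset.mem_univ i)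
      _ ≤ M := hM
      _ ≤ m := by exact_mod_cast hm
  have hinv : W ⊆ (fun y : Fin n → UnitAddCircle => 2 • y) ⁻¹' W := fun y hy =>
    Set.mem_iInter.2 fun m => two_nsmul_mem_torusApprox (Set.mem_iInter.1 hy _)
  rcases (ergodic_two_nsmul_torus n).ae_empty_or_univ_of_ae_le_preimage hWm.nullMeasurableSet
    hinv.eventuallyLE with h | h
  · rw [Measure.real, measure_congr h] at hpw
    simp at hpw
  · filter_upwards [eventuallyEq_univ.1 h] with y hy
    exact Set.mem_iInter.1 hy 0

theorem measurePreserving_torus_mk (n : ℕ) :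
    MeasurePreserving (fun (x : Fin n → ℝ) i => (x i : UnitAddCircle))
      (volume.restrict (Set.univ.pi fun _ => Set.Icc (0 : ℝ) 1)) volume := by
  have h := measurePreserving_pi (fun _ : Fin n => volume.restrict (Set.Icc (0 : ℝ) 1))
    (fun _ => (volume : Measure UnitAddCircle)) (f := fun _ x => (x : UnitAddCircle)) fun _ => by
      rw [← Measure.restrict_congr_set Ioc_ae_eq_Icc]
      simpa using UnitAddCircle.measurePreserving_mk 0
  rw [← Measure.restrict_pi_pi] at h
  exact h

theorem nint_le_norm (x : ℝ) : nint x ≤ ‖(x : UnitAddCircle)‖ := by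
  rw [UnitAddCircle.norm_eq]
  exact ciInf_le ⟨0, by rintro _ ⟨z, rfl⟩; exact abs_nonneg _⟩ (round x)

/-- **Khintchine's theorem, divergence case**: if `Σ_h ψ₁(h) ⋯ ψ_n(h) = ∞` then
`S_n(ψ₁, …, ψ_n)` has full `n`-dimensional Lebesgue measure, i.e. its complement in
`[0,1]ⁿ` is Lebesgue-null. -/
theorem khintchine_divergence (n : ℕ) (hn : 1 ≤ n) (ψ : Fin n → ℕ → ℝ)
    (hpos : ∀ i q, 0 < ψ i q) (hdec : ∀ i, Antitone (ψ i))
    (hsum : ¬ Summable (fun h : ℕ => ∏ i, ψ i h)) :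
    volume ((Set.univ.pi fun _ => Set.Icc (0 : ℝ) 1) \ Sn n ψ) = 0 := by
  have hbox : MeasurableSet (Set.univ.pi fun _ : Fin n => Set.Icc (0 : ℝ) 1) :=
    MeasurableSet.univ_pi fun _ => measurableSet_Icc
  have h := (measurePreserving_torus_mk n).quasiMeasurePreserving.ae
    (ae_mem_torusApprox_zero hn ψ hpos hdec hsum)
  rw [ae_restrict_iff' hbox, ae_iff] at h
  refine measure_mono_null ?_ h
  rintro x ⟨hx, hxS⟩ hmem
  refine hxS (Nat.frequently_atTop_iff_infinite.1 ?_)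
  refine (Filter.Frequently.and_eventually (hmem hx) (Filter.eventually_gt_atTop 0)).mono ?_
  rintro q ⟨hq, hq0⟩
  refine ⟨hq0, fun i => (nint_le_norm _).trans_lt ?_⟩
  have hi := hq i
  rw [← AddCircle.coe_nsmul, nsmul_eq_mul] at hi
  simpa using hi
end

section
/- (Schmidt's theorem.) Let τ > 1/2 and let ψ(q) = q^{−τ}. Then ℋ¹(C_f ∩ S₂(ψ, ψ)) = 0; equivalently, the set of x ∈ I such that there are infinitely many q ∈ ℕ with ‖qx‖ < q^{−τ} and ‖q f(x)‖ < q^{−τ} has Lebesgue measure zero. -/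
open MeasureTheory

/-- `S₂(ψ₁, ψ₂)`: points `(x, y) ∈ ℝ²` with `‖qx‖ < ψ₁(q)` and `‖qy‖ < ψ₂(q)` for
infinitely many `q ∈ ℕ`. -/
def S2 (ψ₁ ψ₂ : ℕ → ℝ) : Set (EuclideanSpace ℝ (Fin 2)) :=
  { p | {q : ℕ | 0 < q ∧ nint (q * p 0) < ψ₁ q ∧ nint (q * p 1) < ψ₂ q}.Infinite }

/-- The integer affine form `a + b x + c f(x)` on the graph of `f`. -/
def affineForm (f : ℝ → ℝ) (a b c : ℤ) (x : ℝ) : ℝ := a + b * x + c * f x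

/-- The derivative `b + c g(x)` of `affineForm f a b c` when `g` is the derivative of `f`. -/
def affineFormDeriv (g : ℝ → ℝ) (b c : ℤ) (x : ℝ) : ℝ := b + c * g x

/-- On `[α, β]` the function `f` has derivative `g`, whose difference quotients lie in `[m₀, M]`. -/
structure UniformlyConvexOn (f g : ℝ → ℝ) (α β m₀ M : ℝ) : Prop where
  hasDerivAt : ∀ x ∈ Set.Icc α β, HasDerivAt f (g x) x
  lower : ∀ x ∈ Set.Icc α β, ∀ y ∈ Set.Icc α β, x ≤ y → m₀ * (y - x) ≤ g y - g x
  upper : ∀ x ∈ Set.Icc α β, ∀ y ∈ Set.Icc α β, x ≤ y → g y - g x ≤ M * (y - x)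
  m₀_pos : 0 < m₀
  M_pos : 0 < M

/-- Points within `η / q` of a rational number with denominator `q`, for some `0 < q ≤ Q`. -/
def nearRational (Q η : ℝ) : Set ℝ :=
  {x | ∃ q p : ℤ, 0 < q ∧ (q : ℝ) ≤ Q ∧ |q * x - p| ≤ η}

theorem volume_le_of_dist_le {S : Set ℝ} {d : ℝ}
    (h : ∀ x ∈ S, ∀ y ∈ S, x ≤ y → y - x ≤ d) : volume S ≤ ENNReal.ofReal d := by
  refine (Real.volume_le_diam S).trans (Metric.ediam_le fun x hx y hy => ?_)
  rw [edist_dist, Real.dist_eq]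
  refine ENNReal.ofReal_le_ofReal ?_
  rcases le_total x y with hxy | hxy
  · rw [abs_sub_comm, abs_of_nonneg (by linarith)]; exact h x hx y hy hxy
  · rw [abs_of_nonneg (by linarith)]; exact h y hy x hx hxy

theorem volume_biUnion_finset_le_card_mul {ι : Type*} (s : Finset ι) (A : ι → Set ℝ) {d : ℝ}
    (h : ∀ i ∈ s, volume (A i) ≤ ENNReal.ofReal d) :
    volume (⋃ i ∈ s, A i) ≤ ENNReal.ofReal (s.card * d) := by
  refine (measure_biUnion_finset_le s A).trans ((Finset.sum_le_sum h).trans ?_)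
  rw [Finset.sum_const, nsmul_eq_mul, ENNReal.ofReal_mul (by positivity), ENNReal.ofReal_natCast]

theorem volume_union_le_ofReal_add {S A B : Set ℝ} {u v : ℝ} (hu : 0 ≤ u) (hv : 0 ≤ v)
    (hS : S ⊆ A ∪ B) (hA : volume A ≤ ENNReal.ofReal u) (hB : volume B ≤ ENNReal.ofReal v) :
    volume S ≤ ENNReal.ofReal (u + v) := by
  rw [ENNReal.ofReal_add hu hv]
  exact (measure_mono hS).trans ((measure_union_le A B).trans (add_le_add hA hB))

theorem volume_le_of_forall_arc {S : Set ℝ} {α β r V : ℝ} (hr : 0 < r) (hV : 0 ≤ V)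
    (hαβ : α ≤ β) (hS : S ⊆ Set.Icc α β)
    (h : ∀ y, volume (S ∩ Set.Icc y (y + r)) ≤ ENNReal.ofReal V) :
    volume S ≤ ENNReal.ofReal (((β - α) / r + 1) * V) := by
  have hsub : S ⊆ ⋃ i ∈ Finset.range (⌊(β - α) / r⌋₊ + 1),
      S ∩ Set.Icc (α + i * r) (α + i * r + r) := by
    intro x hx
    obtain ⟨h1, h2⟩ := hS hx
    have h0 : 0 ≤ (x - α) / r := div_nonneg (by linarith) hr.le
    simp only [Set.mem_iUnion, Finset.mem_range]
    refine ⟨⌊(x - α) / r⌋₊, Nat.lt_succ_of_le (Nat.floor_le_floor (by gcongr)), hx, ?_, ?_⟩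
    · have := Nat.floor_le h0
      rw [le_div_iff₀ hr] at this
      linarith
    · have := (Nat.lt_floor_add_one ((x - α) / r)).le
      rw [div_le_iff₀ hr] at this
      linarith
  refine (measure_mono hsub).trans ((volume_biUnion_finset_le_card_mul _ _ fun i _ => h _).trans ?_)
  refine ENNReal.ofReal_le_ofReal (mul_le_mul_of_nonneg_right ?_ hV)
  rw [Finset.card_range]
  push_cast
  have := Nat.floor_le (div_nonneg (sub_nonneg.2 hαβ) hr.le)
  linarith

theorem volume_inter_nearRational_le {α β Q η : ℝ} (hαβ : α ≤ β) (hQ : 0 ≤ Q) (hη : 0 ≤ η)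
    (hη1 : η ≤ 1) :
    volume (Set.Icc α β ∩ nearRational Q η) ≤
      ENNReal.ofReal (2 * (β - α + 3) * (Q * η)) := by
  have hsub : Set.Icc α β ∩ nearRational Q η ⊆ ⋃ q ∈ Finset.Icc (1 : ℤ) ⌊Q⌋,
      ⋃ p ∈ Finset.Icc ⌈q * α - 1⌉ ⌊q * β + 1⌋, {x : ℝ | |q * x - p| ≤ η} := by
    rintro x ⟨⟨h1, h2⟩, q, p, hq, hqQ, hp⟩
    have hq0 : (0 : ℝ) < q := by exact_mod_cast hq
    have h3 := abs_le.1 hp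
    simp only [Set.mem_iUnion, Finset.mem_Icc]
    refine ⟨q, ⟨by omega, Int.le_floor.2 hqQ⟩, p, ⟨Int.ceil_le.2 ?_, Int.le_floor.2 ?_⟩, hp⟩
    · nlinarith
    · nlinarith
  have hpiece : ∀ q ∈ Finset.Icc (1 : ℤ) ⌊Q⌋,
      volume (⋃ p ∈ Finset.Icc ⌈q * α - 1⌉ ⌊q * β + 1⌋, {x : ℝ | |q * x - p| ≤ η}) ≤
        ENNReal.ofReal (2 * (β - α + 3) * η) := by
    intro q hq
    have hq1 : (1 : ℝ) ≤ q := by exact_mod_cast (Finset.mem_Icc.1 hq).1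
    refine (volume_biUnion_finset_le_card_mul (d := 2 * η / q) _ _ fun p _ => ?_).trans ?_
    · refine volume_le_of_dist_le fun x hx y hy _ => ?_
      have h1 := abs_le.1 (Set.mem_ofPred_eq ▸ hx)
      have h2 := abs_le.1 (Set.mem_ofPred_eq ▸ hy)
      rw [le_div_iff₀ (by linarith)]
      nlinarith
    · refine ENNReal.ofReal_le_ofReal ?_
      have hcard : ((Finset.Icc ⌈q * α - 1⌉ ⌊q * β + 1⌋).card : ℝ) ≤ q * (β - α + 3) := by
        rw [Int.card_Icc]
        have h1 := Int.floor_le (q * β + 1)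
        have h2 := Int.le_ceil (q * α - 1)
        have h4 : 0 ≤ q * (β - α + 3) := by nlinarith
        rcases le_total 0 (⌊q * β + 1⌋ + 1 - ⌈q * α - 1⌉) with h3 | h3
        · rw [← Int.cast_natCast, Int.toNat_of_nonneg h3]
          push_cast
          nlinarith
        · rw [Int.toNat_of_nonpos h3]; simpa using h4
      calc _ ≤ q * (β - α + 3) * (2 * η / q) := by gcongr
        _ = _ := by field_simp
  refine (measure_mono hsub).trans ((volume_biUnion_finset_le_card_mul _ _ hpiece).trans ?_)
  refine ENNReal.ofReal_le_ofReal ?_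
  have hcard : ((Finset.Icc (1 : ℤ) ⌊Q⌋).card : ℝ) ≤ Q := by
    rw [Int.card_Icc, add_sub_cancel_right, ← Int.cast_natCast,
      Int.toNat_of_nonneg (Int.floor_nonneg.2 hQ)]
    exact Int.floor_le Q
  have h0 : 0 ≤ 2 * (β - α + 3) * η := mul_nonneg (by linarith) hη
  nlinarith

namespace UniformlyConvexOn

variable {f g : ℝ → ℝ} {α β m₀ M : ℝ}

theorem exists_affineForm_sub (h : UniformlyConvexOn f g α β m₀ M) (a b c : ℤ) {x y : ℝ}
    (hx : x ∈ Set.Icc α β) (hy : y ∈ Set.Icc α β) (hxy : x ≤ y) :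
    ∃ z ∈ Set.Icc x y, affineForm f a b c y - affineForm f a b c x =
      affineFormDeriv g b c z * (y - x) := by
  rcases hxy.eq_or_lt with rfl | hlt
  · exact ⟨x, ⟨le_rfl, le_rfl⟩, by simp⟩
  have hd : ∀ z ∈ Set.Icc x y, HasDerivAt (affineForm f a b c) (affineFormDeriv g b c z) z := by
    intro z hz
    have h1 := h.hasDerivAt z ⟨hx.1.trans hz.1, hz.2.trans hy.2⟩
    have := (((hasDerivAt_id z).const_mul (b : ℝ)).const_add (a : ℝ)).add (h1.const_mul (c : ℝ))
    rw [mul_one] at this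
    exact this
  obtain ⟨z, hz, hz'⟩ := exists_hasDerivAt_eq_slope _ _ hlt
    (fun z hz => (hd z hz).continuousAt.continuousWithinAt)
    (fun z hz => hd z (Set.Ioo_subset_Icc_self hz))
  refine ⟨z, Set.Ioo_subset_Icc_self hz, ?_⟩
  rw [hz', div_mul_cancel₀ _ (by linarith)]

theorem abs_affineFormDeriv_sub_le (h : UniformlyConvexOn f g α β m₀ M) (b c : ℤ) {x y r : ℝ}
    (hx : x ∈ Set.Icc α β) (hy : y ∈ Set.Icc α β) (hxy : |x - y| ≤ r) :
    |affineFormDeriv g b c x - affineFormDeriv g b c y| ≤ |(c : ℝ)| * (M * r) := by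
  have hM := h.M_pos
  have hm := h.m₀_pos
  have : affineFormDeriv g b c x - affineFormDeriv g b c y = c * (g x - g y) := by
    unfold affineFormDeriv; ring
  rw [this, abs_mul]
  refine mul_le_mul_of_nonneg_left ?_ (abs_nonneg _)
  have hr := abs_le.1 hxy
  rcases le_total x y with hle | hle
  · have h1 := h.lower x hx y hy hle
    have h2 := h.upper x hx y hy hle
    rw [abs_le]; constructor <;> nlinarith
  · have h1 := h.lower y hy x hx hle
    have h2 := h.upper y hy x hx hle
    rw [abs_le]; constructor <;> nlinarith

/-- Transfer of a bound on a form and its derivative to a nearby point. -/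
theorem abs_affineForm_le (h : UniformlyConvexOn f g α β m₀ M) (a b c : ℤ) {x y r δ D : ℝ}
    (hx : x ∈ Set.Icc α β) (hy : y ∈ Set.Icc α β) (hxy : |x - y| ≤ r)
    (hF : |affineForm f a b c y| ≤ δ) (hF' : |affineFormDeriv g b c y| ≤ D) :
    |affineForm f a b c x| ≤ δ + (D + |(c : ℝ)| * (M * r)) * r := by
  have key : ∃ z ∈ Set.Icc α β, |z - y| ≤ r ∧ |affineForm f a b c x - affineForm f a b c y| =
      |affineFormDeriv g b c z| * |x - y| := by
    rcases le_total x y with hle | hle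
    · obtain ⟨z, hz, hz'⟩ := h.exists_affineForm_sub a b c hx hy hle
      refine ⟨z, ⟨hx.1.trans hz.1, hz.2.trans hy.2⟩, ?_, ?_⟩
      · rw [abs_sub_comm, abs_of_nonneg (by linarith [hz.2])] at hxy ⊢
        linarith [hz.1]
      · rw [abs_sub_comm, hz', abs_mul, abs_sub_comm y x]
    · obtain ⟨z, hz, hz'⟩ := h.exists_affineForm_sub a b c hy hx hle
      refine ⟨z, ⟨hy.1.trans hz.1, hz.2.trans hx.2⟩, ?_, ?_⟩
      · rw [abs_of_nonneg (by linarith [hz.1])]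
        rw [abs_of_nonneg (by linarith)] at hxy
        linarith [hz.2]
      · rw [hz', abs_mul]
  obtain ⟨z, hz, hzy, hz'⟩ := key
  have h1 := h.abs_affineFormDeriv_sub_le b c hz hy hzy
  have h2 : |affineFormDeriv g b c z| ≤ D + |(c : ℝ)| * (M * r) := by
    have := abs_sub_abs_le_abs_sub (affineFormDeriv g b c z) (affineFormDeriv g b c y)
    linarith
  have h3 := abs_sub_abs_le_abs_sub (affineForm f a b c x) (affineForm f a b c y)
  have h4 : |affineFormDeriv g b c z| * |x - y| ≤ (D + |(c : ℝ)| * (M * r)) * r :=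
    mul_le_mul h2 hxy (abs_nonneg _) ((abs_nonneg _).trans h2)
  linarith

theorem volume_small_form_pos_deriv_le (h : UniformlyConvexOn f g α β m₀ M) (a b c : ℤ)
    {δ ω : ℝ} (hω : 0 < ω) :
    volume {x ∈ Set.Icc α β | |affineForm f a b c x| ≤ δ ∧ ω ≤ affineFormDeriv g b c x} ≤
      ENNReal.ofReal (2 * δ / ω) := by
  refine volume_le_of_dist_le ?_
  rintro x ⟨hx, hx1, hx2⟩ y ⟨hy, hy1, hy2⟩ hxy
  obtain ⟨z, hz, hz'⟩ := h.exists_affineForm_sub a b c hx hy hxy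
  have hzJ : z ∈ Set.Icc α β := ⟨hx.1.trans hz.1, hz.2.trans hy.2⟩
  have hm := h.m₀_pos
  have hω' : ω ≤ affineFormDeriv g b c z := by
    have h1 : g x ≤ g z := by nlinarith [h.lower x hx z hzJ hz.1, hz.1]
    have h2 : g z ≤ g y := by nlinarith [h.lower z hzJ y hy hz.2, hz.2]
    unfold affineFormDeriv at *
    rcases le_total 0 (c : ℝ) with hc | hc <;> nlinarith
  have h1 := abs_le.1 hx1
  have h2 := abs_le.1 hy1
  rw [le_div_iff₀ hω]
  nlinarith

theorem volume_small_form_large_deriv_le (h : UniformlyConvexOn f g α β m₀ M) (a b c : ℤ)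
    {δ ω : ℝ} (hω : 0 < ω) (hδ : 0 ≤ δ) :
    volume {x ∈ Set.Icc α β | |affineForm f a b c x| ≤ δ ∧ ω ≤ |affineFormDeriv g b c x|} ≤
      ENNReal.ofReal (4 * δ / ω) := by
  have hpos : 0 ≤ 2 * δ / ω := by positivity
  have h1 := volume_union_le_ofReal_add hpos hpos (S := {x ∈ Set.Icc α β |
    |affineForm f a b c x| ≤ δ ∧ ω ≤ |affineFormDeriv g b c x|}) ?_
    (h.volume_small_form_pos_deriv_le a b c (δ := δ) hω)
    (h.volume_small_form_pos_deriv_le (-a) (-b) (-c) (δ := δ) hω)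
  · rwa [show 4 * δ / ω = 2 * δ / ω + 2 * δ / ω by ring]
  · rintro x ⟨hx, hx1, hx2⟩
    rcases le_abs'.1 hx2 with h3 | h3
    · right
      refine ⟨hx, ?_, ?_⟩
      · rw [show affineForm f (-a) (-b) (-c) x = -affineForm f a b c x by
          unfold affineForm; push_cast; ring, abs_neg]
        exact hx1
      · unfold affineFormDeriv at *; push_cast; linarith
    · exact Or.inl ⟨hx, hx1, h3⟩

theorem volume_small_deriv_le (h : UniformlyConvexOn f g α β m₀ M) (b : ℤ) {c : ℤ}
    {ω u : ℝ} (hu : 0 < u) (huc : u ≤ c) :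
    volume {x ∈ Set.Icc α β | |affineFormDeriv g b c x| ≤ ω} ≤
      ENNReal.ofReal (2 * ω / (u * m₀)) := by
  refine volume_le_of_dist_le ?_
  rintro x ⟨hx, hx1⟩ y ⟨hy, hy1⟩ hxy
  have hm := h.m₀_pos
  have h1 := abs_le.1 hx1
  have h2 := abs_le.1 hy1
  have h3 := h.lower x hx y hy hxy
  rw [le_div_iff₀ (by positivity)]
  unfold affineFormDeriv at *
  have h4 : u * (m₀ * (y - x)) ≤ c * (g y - g x) :=
    mul_le_mul huc h3 (mul_nonneg hm.le (by linarith)) (by linarith)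
  nlinarith

theorem volume_small_form_le (h : UniformlyConvexOn f g α β m₀ M) (a b : ℤ) {c : ℤ}
    {δ u : ℝ} (hδ : 0 < δ) (hu : 0 < u) (huc : u ≤ c) :
    volume {x ∈ Set.Icc α β | |affineForm f a b c x| ≤ δ} ≤
      ENNReal.ofReal ((4 + 2 / m₀) * √(δ / u)) := by
  have hm := h.m₀_pos
  have hω : 0 < √(δ * u) := by positivity
  have e1 : 4 * δ / √(δ * u) = 4 * √(δ / u) := by
    rw [Real.sqrt_mul hδ.le, Real.sqrt_div hδ.le]
    nth_rw 1 [← Real.mul_self_sqrt hδ.le]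
    field_simp
  have e2 : 2 * √(δ * u) / (u * m₀) = 2 / m₀ * √(δ / u) := by
    rw [Real.sqrt_mul hδ.le, Real.sqrt_div hδ.le]
    nth_rw 2 [← Real.mul_self_sqrt hu.le]
    field_simp
  rw [add_mul, ← e1, ← e2]
  refine volume_union_le_ofReal_add (by positivity) (by positivity) ?_
    (h.volume_small_form_large_deriv_le a b c (δ := δ) hω hδ.le)
    (h.volume_small_deriv_le b hu huc)
  rintro x ⟨hx, hx1⟩
  rcases le_total (√(δ * u)) |affineFormDeriv g b c x| with h1 | h1
  · exact Or.inl ⟨hx, hx1, h1⟩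
  · exact Or.inr ⟨hx, h1⟩

end UniformlyConvexOn

theorem exists_ne_abs_sub_le_of_card {ι : Type*} {s : Finset ι} {u : ι → ℝ} {n : ℕ} (hn : 0 < n)
    (hcard : n + 1 < s.card) (hu : ∀ i ∈ s, |u i| ≤ 1) :
    ∃ i ∈ s, ∃ j ∈ s, i ≠ j ∧ |u i - u j| ≤ 2 / n := by
  have hn' : (0 : ℝ) < n := by exact_mod_cast hn
  have hnn : ∀ i ∈ s, 0 ≤ (u i + 1) * n / 2 := fun i hi => by
    have := (abs_le.1 (hu i hi)).1
    have : 0 ≤ (u i + 1) * n := mul_nonneg (by linarith) hn'.le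
    linarith
  obtain ⟨i, hi, j, hj, hij, heq⟩ := Finset.exists_ne_map_eq_of_card_lt_of_maps_to
    (t := Finset.range (n + 1)) (f := fun i => ⌊(u i + 1) * n / 2⌋₊) (by simpa using hcard)
    (fun i hi => by
      simp only [Finset.coe_range, Set.mem_Iio]
      refine Nat.lt_succ_of_le (Nat.floor_le_of_le ?_)
      have := (abs_le.1 (hu i hi)).2
      nlinarith)
  refine ⟨i, hi, j, hj, hij, ?_⟩
  have h1 := Nat.floor_le (hnn i hi)
  have h2 := Nat.lt_floor_add_one ((u i + 1) * n / 2)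
  have h3 := Nat.floor_le (hnn j hj)
  have h4 := Nat.lt_floor_add_one ((u j + 1) * n / 2)
  rw [heq] at h1 h2
  rw [abs_le, neg_le, le_div_iff₀ hn', le_div_iff₀ hn']
  constructor <;> linarith

/-- Among many collinear points of the square `[-1, 1]²`, two are close in both coordinates. -/
theorem exists_ne_abs_sub_le_of_collinear {ι : Type*} {s : Finset ι} {u v : ι → ℝ} {n : ℕ}
    (hn : 0 < n) (hcard : n + 1 < s.card) (hu : ∀ i ∈ s, |u i| ≤ 1) (hv : ∀ i ∈ s, |v i| ≤ 1)
    (hcol : ∀ i ∈ s, ∀ j ∈ s, ∀ k ∈ s,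
      (u j - u i) * (v k - v i) = (u k - u i) * (v j - v i)) :
    ∃ i ∈ s, ∃ j ∈ s, i ≠ j ∧ |u i - u j| ≤ 2 / n ∧ |v i - v j| ≤ 2 / n := by
  obtain ⟨i₀, hi₀, j₀, hj₀, hne⟩ := Finset.one_lt_card.1 (show 1 < s.card by omega)
  have main : ∀ u v : ι → ℝ, (∀ i ∈ s, |u i| ≤ 1) → (∀ i ∈ s, ∀ j ∈ s, ∀ k ∈ s,
      (u j - u i) * (v k - v i) = (u k - u i) * (v j - v i)) → u j₀ - u i₀ ≠ 0 →
      |v j₀ - v i₀| ≤ |u j₀ - u i₀| →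
      ∃ i ∈ s, ∃ j ∈ s, i ≠ j ∧ |u i - u j| ≤ 2 / n ∧ |v i - v j| ≤ 2 / n := by
    intro u v hu hcol h0 hle
    obtain ⟨i, hi, j, hj, hij, h1⟩ := exists_ne_abs_sub_le_of_card hn hcard hu
    refine ⟨i, hi, j, hj, hij, h1, le_trans ?_ h1⟩
    have e1 := hcol i₀ hi₀ j₀ hj₀ i hi
    have e2 := hcol i₀ hi₀ j₀ hj₀ j hj
    have e3 : (u j₀ - u i₀) * (v i - v j) = (u i - u j) * (v j₀ - v i₀) := by linarith
    have e4 := congrArg abs e3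
    rw [abs_mul, abs_mul] at e4
    have hpos := abs_pos.2 h0
    refine le_of_mul_le_mul_left ?_ hpos
    rw [e4, mul_comm]
    exact mul_le_mul_of_nonneg_right hle (abs_nonneg _)
  rcases le_total |v j₀ - v i₀| |u j₀ - u i₀| with hle | hle
  · by_cases h0 : u j₀ - u i₀ = 0
    · have hv0 : v j₀ - v i₀ = 0 := by
        rw [h0, abs_zero] at hle
        exact abs_eq_zero.1 (le_antisymm hle (abs_nonneg _))
      exact ⟨j₀, hj₀, i₀, hi₀, hne.symm, by rw [h0, abs_zero]; positivity,
        by rw [hv0, abs_zero]; positivity⟩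
    · exact main u v hu hcol h0 hle
  · by_cases h0 : v j₀ - v i₀ = 0
    · have hu0 : u j₀ - u i₀ = 0 := by
        rw [h0, abs_zero] at hle
        exact abs_eq_zero.1 (le_antisymm hle (abs_nonneg _))
      exact ⟨j₀, hj₀, i₀, hi₀, hne.symm, by rw [hu0, abs_zero]; positivity,
        by rw [h0, abs_zero]; positivity⟩
    · obtain ⟨i, hi, j, hj, hij, h1, h2⟩ := main v u hv
        (fun i hi j hj k hk => by linarith [hcol i hi j hj k hk]) h0 hle
      exact ⟨i, hi, j, hj, hij, h2, h1⟩

/-- An integer triple is primitive when its entries generate the unit ideal. -/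
def IsPrimitiveTriple (v : ℤ × ℤ × ℤ) : Prop :=
  ∃ l m n : ℤ, l * v.1 + m * v.2.1 + n * v.2.2 = 1

theorem IsPrimitiveTriple.eq_of_proportional {v w : ℤ × ℤ × ℤ} (hv : IsPrimitiveTriple v)
    (hw : IsPrimitiveTriple w) (hv0 : 0 < v.2.2) (hw0 : 0 < w.2.2)
    (h1 : v.2.2 * w.1 = w.2.2 * v.1) (h2 : v.2.2 * w.2.1 = w.2.2 * v.2.1) : v = w := by
  obtain ⟨l, m, n, e⟩ := hv
  obtain ⟨l', m', n', e'⟩ := hw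
  have d1 : v.2.2 ∣ w.2.2 := ⟨l * w.1 + m * w.2.1 + n * w.2.2, by
    linear_combination (-w.2.2) * e - l * h1 - m * h2⟩
  have d2 : w.2.2 ∣ v.2.2 := ⟨l' * v.1 + m' * v.2.1 + n' * v.2.2, by
    linear_combination (-v.2.2) * e' + l' * h1 + m' * h2⟩
  have h3 : v.2.2 = w.2.2 := Int.dvd_antisymm hv0.le hw0.le d1 d2
  rw [← h3] at h1 h2
  exact Prod.ext (mul_left_cancel₀ hv0.ne' h1).symm
    (Prod.ext (mul_left_cancel₀ hv0.ne' h2).symm h3)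

theorem exists_isPrimitiveTriple_mul {a b c : ℤ} (h : a ≠ 0 ∨ b ≠ 0 ∨ c ≠ 0) :
    ∃ d a' b' c' : ℤ, 0 < d ∧ a = d * a' ∧ b = d * b' ∧ c = d * c' ∧
      IsPrimitiveTriple (a', b', c') := by
  set e : ℕ := Int.gcd a b with he
  set d : ℕ := Int.gcd e c with hd
  have hd0 : (d : ℤ) ≠ 0 := by
    intro h0
    have h0' : d = 0 := by exact_mod_cast h0
    rw [hd, Int.gcd_eq_zero_iff] at h0'
    have : e = 0 := by exact_mod_cast h0'.1
    rw [he, Int.gcd_eq_zero_iff] at this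
    tauto
  have hde : (d : ℤ) ∣ e := Int.gcd_dvd_left ..
  obtain ⟨a', ha⟩ := hde.trans (Int.gcd_dvd_left a b)
  obtain ⟨b', hb⟩ := hde.trans (Int.gcd_dvd_right a b)
  obtain ⟨c', hc⟩ : (d : ℤ) ∣ c := Int.gcd_dvd_right ..
  refine ⟨d, a', b', c', by omega, ha, hb, hc, Int.gcdA e c * Int.gcdA a b,
    Int.gcdA e c * Int.gcdB a b, Int.gcdB e c, mul_left_cancel₀ hd0 ?_⟩
  have h1 := Int.gcd_eq_gcd_ab a b
  have h2 := Int.gcd_eq_gcd_ab e c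
  rw [← he] at h1
  rw [← hd] at h2
  simp only
  linear_combination (-Int.gcdA e c * Int.gcdA a b) * ha - Int.gcdA e c * Int.gcdB a b * hb
    - Int.gcdB e c * hc - h2 - Int.gcdA e c * h1

/-- A point far from rationals of small denominator admits few primitive forms of given size that
are small together with their derivative. -/
theorem card_le_of_notMem_nearRational {f g : ℝ → ℝ} {s : Finset (ℤ × ℤ × ℤ)} {x H θ T u : ℝ}
    {n : ℕ} (hθ : 73 ≤ θ) (hu : 1 ≤ u) (huH : u ≤ H) (hT : 0 < T) (hTH : T < H)
    (hn : 16 * u / T ≤ n) (hx : x ∉ nearRational T (T / H))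
    (hs : ∀ v ∈ s, IsPrimitiveTriple v ∧ u ≤ v.2.2 ∧ (v.2.2 : ℝ) ≤ 2 * u ∧
      |affineForm f v.1 v.2.1 v.2.2 x| ≤ 3 / (H * θ) ∧ |affineFormDeriv g v.2.1 v.2.2 x| ≤ 2) :
    s.card ≤ n + 1 := by
  by_contra! hcard
  have hu0 : 0 < u := by linarith
  have hH : 0 < H := by linarith
  have hn0 : (0 : ℝ) < n := lt_of_lt_of_le (by positivity) hn
  set F : ℤ × ℤ × ℤ → ℝ := fun v => affineForm f v.1 v.2.1 v.2.2 x with hF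
  set F' : ℤ × ℤ × ℤ → ℝ := fun v => affineFormDeriv g v.2.1 v.2.2 x with hF'
  set c : ℤ × ℤ × ℤ → ℝ := fun v => (v.2.2 : ℝ) with hc
  have hc0 : ∀ v ∈ s, 0 < c v := fun v hv => hu0.trans_le (hs v hv).2.1
  have hcu : ∀ v ∈ s, c v ≤ 2 * u := fun v hv => (hs v hv).2.2.1
  have hdet : ∀ i ∈ s, ∀ j ∈ s, ∀ k ∈ s, c i * (F' j * F k - F' k * F j)
      - c j * (F' i * F k - F' k * F i) + c k * (F' i * F j - F' j * F i) = 0 := by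
    intro i hi j hj k hk
    have hint : c i * (F' j * F k - F' k * F j)
        - c j * (F' i * F k - F' k * F i) + c k * (F' i * F j - F' j * F i) =
        ((i.2.2 * (j.2.1 * k.1 - k.2.1 * j.1) - j.2.2 * (i.2.1 * k.1 - k.2.1 * i.1)
          + k.2.2 * (i.2.1 * j.1 - j.2.1 * i.1) : ℤ) : ℝ) := by
      simp only [hF, hF', hc, affineForm, affineFormDeriv]
      push_cast
      ring
    have hterm : ∀ v ∈ s, ∀ w ∈ s, ∀ z ∈ s, |c v * (F' w * F z)| ≤ 12 / θ := by
      intro v hv w hw z hz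
      rw [abs_mul, abs_mul, abs_of_pos (hc0 v hv)]
      calc c v * (|F' w| * |F z|) ≤ (2 * H) * (2 * (3 / (H * θ))) := by
            have h1 := (hs w hw).2.2.2.2
            have h2 := (hs z hz).2.2.2.1
            have h3 := (hcu v hv).trans (by linarith : 2 * u ≤ 2 * H)
            gcongr
        _ = 12 / θ := by field_simp; norm_num
    have hsmall : |c i * (F' j * F k - F' k * F j)
        - c j * (F' i * F k - F' k * F i) + c k * (F' i * F j - F' j * F i)| < 1 := by
      have t1 := abs_le.1 (hterm i hi j hj k hk)
      have t2 := abs_le.1 (hterm i hi k hk j hj)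
      have t3 := abs_le.1 (hterm j hj i hi k hk)
      have t4 := abs_le.1 (hterm j hj k hk i hi)
      have t5 := abs_le.1 (hterm k hk i hi j hj)
      have t6 := abs_le.1 (hterm k hk j hj i hi)
      have t7 : 12 / θ ≤ 12 / 73 := by gcongr
      rw [abs_lt]
      constructor <;> linarith
    rw [hint] at hsmall ⊢
    exact_mod_cast Int.abs_lt_one_iff.1 (by exact_mod_cast hsmall)
  obtain ⟨v, hv, w, hw, hvw, h1, h2⟩ := exists_ne_abs_sub_le_of_collinear (s := s)
    (u := fun v => F' v / c v * (u / 2)) (v := fun v => F v / c v * (u * H * θ / 3))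
    (n := n) (by exact_mod_cast hn0) hcard
    (by
      intro v hv
      have h0 := hc0 v hv
      have h1 : |F' v| ≤ 2 := (hs v hv).2.2.2.2
      have h2 : u ≤ c v := (hs v hv).2.1
      rw [abs_mul, abs_div, abs_of_pos h0, abs_of_pos (by positivity : 0 < u / 2)]
      calc |F' v| / c v * (u / 2) ≤ 2 / u * (u / 2) := by gcongr
        _ = 1 := by field_simp)
    (by
      intro v hv
      have h0 := hc0 v hv
      have h1 : |F v| ≤ 3 / (H * θ) := (hs v hv).2.2.2.1
      have h2 : u ≤ c v := (hs v hv).2.1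
      rw [abs_mul, abs_div, abs_of_pos h0, abs_of_pos (by positivity : 0 < u * H * θ / 3)]
      calc |F v| / c v * (u * H * θ / 3) ≤ 3 / (H * θ) / u * (u * H * θ / 3) := by gcongr
        _ = 1 := by field_simp)
    (by
      intro i hi j hj k hk
      have h := hdet i hi j hj k hk
      have hi0 := (hc0 i hi).ne'
      have hj0 := (hc0 j hj).ne'
      have hk0 := (hc0 k hk).ne'
      field_simp
      linear_combination c i * h)
  have hv0 := hc0 v hv
  have hw0 := hc0 w hw
  have hcc : c v * c w ≤ 4 * u ^ 2 := by nlinarith [hcu v hv, hcu w hw]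
  have hnT : u / n ≤ T / 16 := by
    rw [div_le_iff₀ hT] at hn
    rw [div_le_iff₀ hn0]
    linarith
  set q : ℤ := v.2.1 * w.2.2 - w.2.1 * v.2.2 with hq
  set p : ℤ := v.2.2 * w.1 - w.2.2 * v.1 with hp
  have hqT : |(q : ℝ)| ≤ T := by
    have e : (q : ℝ) = c v * c w * (2 / u) * (F' v / c v * (u / 2) - F' w / c w * (u / 2)) := by
      field_simp
      simp only [hq, hF', hc, affineFormDeriv]
      push_cast
      ring
    rw [e, abs_mul, abs_of_pos (by positivity)]
    calc _ ≤ 4 * u ^ 2 * (2 / u) * (2 / n) := by gcongr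
      _ = 16 * (u / n) := by field_simp; norm_num
      _ ≤ T := by linarith
  have hpT : |q * x - p| ≤ T / H := by
    have e : q * x - p =
        c v * c w * (3 / (u * H * θ)) * (F v / c v * (u * H * θ / 3) - F w / c w * (u * H * θ / 3))
        := by
      field_simp
      simp only [hq, hp, hF, hc, affineForm]
      push_cast
      ring
    rw [e, abs_mul, abs_of_pos (by positivity)]
    calc _ ≤ 4 * u ^ 2 * (3 / (u * H * θ)) * (2 / n) := by gcongr
      _ = 24 * (u / n) / (H * θ) := by field_simp; norm_num
      _ ≤ 24 * (T / 16) / (H * 2) := by gcongr; linarith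
      _ ≤ T / H := by rw [div_le_div_iff₀ (by positivity) hH]; nlinarith [mul_pos hT hH]
  rcases lt_trichotomy q 0 with hq0 | hq0 | hq0
  · refine hx ⟨-q, -p, by omega, ?_, ?_⟩
    · push_cast; exact (neg_le_abs _).trans hqT
    · rw [← abs_neg]; push_cast; convert hpT using 2; ring
  · have hp0 : p = 0 := by
      rw [hq0, Int.cast_zero, zero_mul, zero_sub, abs_neg] at hpT
      have : |(p : ℝ)| < 1 := hpT.trans_lt ((div_lt_one hH).2 hTH)
      exact Int.abs_lt_one_iff.1 (by exact_mod_cast this)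
    exact hvw ((hs v hv).1.eq_of_proportional (hs w hw).1 (Int.cast_pos.1 hv0)
      (Int.cast_pos.1 hw0) (by linarith) (by linarith))
  · exact hx ⟨q, p, hq0, (le_abs_self _).trans hqT, hpT⟩

theorem exists_finset_coe_eq_of_forall_card_le {ι : Type*} {P : Set ι} {n : ℕ}
    (h : ∀ s : Finset ι, ↑s ⊆ P → s.card ≤ n) : ∃ t : Finset ι, ↑t = P ∧ t.card ≤ n := by
  have hfin : P.Finite := by
    by_contra hinf
    obtain ⟨s, hs, hcard⟩ := Set.Infinite.exists_subset_card_eq hinf (n + 1)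
    have := h s hs
    omega
  exact ⟨hfin.toFinset, hfin.coe_toFinset, h _ hfin.coe_toFinset.le⟩

namespace UniformlyConvexOn

variable {f g : ℝ → ℝ} {α β m₀ M : ℝ}

theorem volume_forms_small_deriv_le (h : UniformlyConvexOn f g α β m₀ M) (hαβ : α ≤ β)
    {R U θ : ℝ} (hθ : 73 ≤ θ) (hθM : 2 * M ≤ θ) (hU : 1 ≤ U) (hUR : U ≤ R) :
    volume {x ∈ Set.Icc α β \ nearRational (R / θ) (1 / (R * θ)) | ∃ v : ℤ × ℤ × ℤ,
      IsPrimitiveTriple v ∧ U ^ 2 ≤ v.2.2 ∧ (v.2.2 : ℝ) ≤ 2 * U ^ 2 ∧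
      |affineForm f v.1 v.2.1 v.2.2 x| ≤ (1 / (R ^ 2 * θ ^ 4)) ^ 2 ∧
      |affineFormDeriv g v.2.1 v.2.2 x| ≤ 1} ≤
      ENNReal.ofReal (18 * (β - α + 1) * (4 + 2 / m₀) / θ ^ 2) := by
  set S := {x ∈ Set.Icc α β \ nearRational (R / θ) (1 / (R * θ)) | ∃ v : ℤ × ℤ × ℤ,
      IsPrimitiveTriple v ∧ U ^ 2 ≤ v.2.2 ∧ (v.2.2 : ℝ) ≤ 2 * U ^ 2 ∧
      |affineForm f v.1 v.2.1 v.2.2 x| ≤ (1 / (R ^ 2 * θ ^ 4)) ^ 2 ∧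
      |affineFormDeriv g v.2.1 v.2.2 x| ≤ 1} with hS
  have hm := h.m₀_pos
  have hM := h.M_pos
  have hR : 1 ≤ R := hU.trans hUR
  have hθ0 : 0 < θ := by linarith
  have hR0 : 0 < R := by linarith
  have hU0 : 0 < U := by linarith
  have hUR2 : U ^ 2 ≤ R ^ 2 := by gcongr
  set T : ℝ := R / θ with hT
  have hT0 : 0 < T := by positivity
  have hTR : T / R ^ 2 = 1 / (R * θ) := by rw [hT]; field_simp
  set r : ℝ := 1 / (R ^ 2 * θ) with hr
  have hr0 : 0 < r := by positivity
  set n : ℕ := ⌈16 * U ^ 2 / T⌉₊ with hn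
  set V : ℝ := (n + 1) * ((4 + 2 / m₀) * (1 / (R ^ 2 * θ ^ 4 * U))) with hV
  have harc : ∀ y, volume (S ∩ Set.Icc y (y + r)) ≤ ENNReal.ofReal V := by
    intro y
    rcases (S ∩ Set.Icc y (y + r)).eq_empty_or_nonempty with h0 | ⟨x, hxS, hxy⟩
    · rw [h0, measure_empty]; exact zero_le
    obtain ⟨⟨hxJ, hxN⟩, -⟩ := hxS
    obtain ⟨t, htP, ht⟩ := exists_finset_coe_eq_of_forall_card_le (n := n + 1)
      (P := {v : ℤ × ℤ × ℤ | IsPrimitiveTriple v ∧ U ^ 2 ≤ v.2.2 ∧ (v.2.2 : ℝ) ≤ 2 * U ^ 2 ∧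
        ∃ z ∈ Set.Icc α β ∩ Set.Icc y (y + r),
          |affineForm f v.1 v.2.1 v.2.2 z| ≤ (1 / (R ^ 2 * θ ^ 4)) ^ 2 ∧
          |affineFormDeriv g v.2.1 v.2.2 z| ≤ 1}) (by
        intro s hs
        refine card_le_of_notMem_nearRational (f := f) (g := g) (x := x) (H := R ^ 2) (T := T)
          (u := U ^ 2) hθ (one_le_pow₀ hU) hUR2 hT0 ?_ (Nat.le_ceil _) (by rwa [hTR]) ?_
        · rw [hT, div_lt_iff₀ hθ0]
          nlinarith
        · intro v hv
          obtain ⟨hv1, hv2, hv3, z, ⟨hzJ, hzy⟩, hz1, hz2⟩ := hs hv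
          have hxz : |x - z| ≤ r := by
            rw [abs_le]; constructor <;> linarith [hxy.1, hxy.2, hzy.1, hzy.2]
          have hvar : |(v.2.2 : ℝ)| * (M * r) ≤ 1 := by
            rw [abs_of_nonneg (by linarith [sq_nonneg U])]
            calc (v.2.2 : ℝ) * (M * r) ≤ (2 * R ^ 2) * (M * r) := by gcongr; linarith
              _ = 2 * M / θ := by rw [hr]; field_simp
              _ ≤ 1 := by rw [div_le_one hθ0]; exact hθM
          have hδr : (1 / (R ^ 2 * θ ^ 4)) ^ 2 ≤ r := by
            rw [hr, div_pow, one_pow]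
            refine one_div_le_one_div_of_le (by positivity) ?_
            calc R ^ 2 * θ ≤ R ^ 4 * θ ^ 8 := by
                  gcongr ?_ * ?_
                  · exact pow_le_pow_right₀ hR (by norm_num)
                  · exact le_self_pow₀ (by linarith) (by norm_num)
              _ = _ := by ring
          refine ⟨hv1, hv2, hv3, ?_, ?_⟩
          · have := h.abs_affineForm_le v.1 v.2.1 v.2.2 hxJ hzJ hxz hz1 hz2
            have e : 3 / (R ^ 2 * θ) = 3 * r := by rw [hr]; ring
            rw [e]
            nlinarith
          · have h1 := h.abs_affineFormDeriv_sub_le v.2.1 v.2.2 hxJ hzJ hxz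
            have h2 := abs_sub_abs_le_abs_sub (affineFormDeriv g v.2.1 v.2.2 x)
              (affineFormDeriv g v.2.1 v.2.2 z)
            linarith)
    have hsub : S ∩ Set.Icc y (y + r) ⊆ ⋃ v ∈ t, {z ∈ Set.Icc α β |
        |affineForm f v.1 v.2.1 v.2.2 z| ≤ (1 / (R ^ 2 * θ ^ 4)) ^ 2 ∧ U ^ 2 ≤ (v.2.2 : ℝ)} := by
      rintro z ⟨⟨⟨hzJ, -⟩, v, hv1, hv2, hv3, hz1, hz2⟩, hzy⟩
      simp only [Set.mem_iUnion]
      refine ⟨v, ?_, hzJ, hz1, hv2⟩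
      rw [← Finset.mem_coe, htP]
      exact ⟨hv1, hv2, hv3, z, ⟨hzJ, hzy⟩, hz1, hz2⟩
    refine (measure_mono hsub).trans ((volume_biUnion_finset_le_card_mul
      (d := (4 + 2 / m₀) * (1 / (R ^ 2 * θ ^ 4 * U))) t _ fun v hv => ?_).trans ?_)
    · have hv2 : U ^ 2 ≤ (v.2.2 : ℝ) := by
        rw [← Finset.mem_coe, htP] at hv
        exact hv.2.1
      have h1 := h.volume_small_form_le v.1 v.2.1 (δ := (1 / (R ^ 2 * θ ^ 4)) ^ 2)
        (by positivity) (by positivity) hv2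
      rw [← div_pow, Real.sqrt_sq (by positivity), div_div] at h1
      refine (measure_mono ?_).trans h1
      exact fun z hz => ⟨hz.1, hz.2.1⟩
    · refine ENNReal.ofReal_le_ofReal (mul_le_mul_of_nonneg_right ?_ (by positivity))
      exact_mod_cast ht
  refine (volume_le_of_forall_arc hr0 (by positivity) hαβ (fun x hx => hx.1.1) harc).trans
    (ENNReal.ofReal_le_ofReal ?_)
  have hl : 0 ≤ β - α := by linarith
  have h1 : (β - α) / r + 1 ≤ (β - α + 1) * (R ^ 2 * θ) := by
    have : 1 ≤ R ^ 2 * θ := by nlinarith [one_le_pow₀ hR (n := 2)]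
    rw [hr, div_div_eq_mul_div, div_one]
    linarith
  have h2 : (n : ℝ) + 1 ≤ 18 * U * θ := by
    have h3 := (Nat.ceil_lt_add_one (show 0 ≤ 16 * U ^ 2 / T by positivity)).le
    have h4 : 16 * U ^ 2 / T ≤ 16 * U * θ := by
      rw [hT, div_le_iff₀ (by positivity)]
      calc 16 * U ^ 2 = 16 * U * U := by ring
        _ ≤ 16 * U * R := by gcongr
        _ = _ := by field_simp
    nlinarith
  calc ((β - α) / r + 1) * V
      ≤ (β - α + 1) * (R ^ 2 * θ) *
        (18 * U * θ * ((4 + 2 / m₀) * (1 / (R ^ 2 * θ ^ 4 * U)))) := by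
        rw [hV]; gcongr
    _ = _ := by field_simp

theorem volume_forms_dyadic_deriv_le (h : UniformlyConvexOn f g α β m₀ M) (hαβ : α ≤ β)
    {H ρ ω : ℝ} {c : ℤ} (hρ : 0 < ρ) (hρ1 : 5 * ρ < 1) (hHρ : H * M * ρ ≤ 1)
    (hω : 1 ≤ ω) (hcH : |(c : ℝ)| ≤ H) :
    volume {x ∈ Set.Icc α β \ nearRational (2 * H) (5 * ρ) | ∃ a b : ℤ, |(b : ℝ)| ≤ H ∧
      |affineForm f a b c x| ≤ ρ ^ 2 ∧ ω ≤ |affineFormDeriv g b c x| ∧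
      |affineFormDeriv g b c x| ≤ 2 * ω} ≤ ENNReal.ofReal (4 * (β - α + 1) * ρ) := by
  set S := {x ∈ Set.Icc α β \ nearRational (2 * H) (5 * ρ) | ∃ a b : ℤ, |(b : ℝ)| ≤ H ∧
      |affineForm f a b c x| ≤ ρ ^ 2 ∧ ω ≤ |affineFormDeriv g b c x| ∧
      |affineFormDeriv g b c x| ≤ 2 * ω} with hS
  have hω0 : 0 < ω := by linarith
  have hM := h.M_pos
  have harc : ∀ y, volume (S ∩ Set.Icc y (y + ρ / ω)) ≤ ENNReal.ofReal (4 * ρ ^ 2 / ω) := by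
    intro y
    rcases (S ∩ Set.Icc y (y + ρ / ω)).eq_empty_or_nonempty with h0 | ⟨x, hxS, hxy⟩
    · rw [h0, measure_empty]; exact zero_le
    obtain ⟨⟨hxJ, hxN⟩, a, b, hb, hx1, hx2, hx3⟩ := hxS
    refine (measure_mono ?_).trans (h.volume_small_form_large_deriv_le a b c hω0 (sq_nonneg ρ))
    rintro z ⟨⟨⟨hzJ, -⟩, a', b', hb', hz1, hz2, hz3⟩, hzy⟩
    have hxz : |x - z| ≤ ρ / ω := by
      rw [abs_le]; constructor <;> linarith [hxy.1, hxy.2, hzy.1, hzy.2]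
    have h1 : |affineForm f a' b' c x| ≤ 4 * ρ := by
      have h2 := h.abs_affineForm_le a' b' c hxJ hzJ hxz hz1 hz3
      have h3 : |(c : ℝ)| * (M * (ρ / ω)) ≤ 1 :=
        calc |(c : ℝ)| * (M * (ρ / ω)) ≤ H * (M * ρ) := by
              have h4 : 0 ≤ H := (abs_nonneg _).trans hcH
              gcongr
              exact div_le_self hρ.le hω
          _ ≤ 1 := by linarith
      calc |affineForm f a' b' c x| ≤ ρ ^ 2 + (2 * ω + |(c : ℝ)| * (M * (ρ / ω))) * (ρ / ω) := h2
        _ ≤ ρ ^ 2 + (2 * ω + ω) * (ρ / ω) := by gcongr; linarith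
        _ = ρ ^ 2 + 3 * ρ := by field_simp; norm_num
        _ ≤ 4 * ρ := by nlinarith
    have h4 : |((b - b' : ℤ) : ℝ) * x - (a' - a : ℤ)| ≤ 5 * ρ := by
      have e : ((b - b' : ℤ) : ℝ) * x - (a' - a : ℤ) =
          affineForm f a b c x - affineForm f a' b' c x := by
        unfold affineForm; push_cast; ring
      rw [e]
      have := abs_sub (affineForm f a b c x) (affineForm f a' b' c x)
      nlinarith
    have hbb := abs_le.1 hb
    have hbb' := abs_le.1 hb'
    have hbeq : b = b' := by
      rcases lt_trichotomy b b' with hlt | heq | hlt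
      · exact absurd ⟨b' - b, a - a', by omega, by push_cast; linarith, by
          rw [← abs_neg]; convert h4 using 2; push_cast; ring⟩ hxN
      · exact heq
      · exact absurd ⟨b - b', a' - a, by omega, by push_cast; linarith, h4⟩ hxN
    have haeq : a' - a = 0 := by
      rw [hbeq, sub_self, Int.cast_zero, zero_mul, zero_sub, abs_neg] at h4
      have : |((a' - a : ℤ) : ℝ)| < 1 := h4.trans_lt hρ1
      exact Int.abs_lt_one_iff.1 (by exact_mod_cast this)
    obtain rfl : a = a' := by omega
    subst hbeq
    exact ⟨hzJ, hz1, hz2⟩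
  refine (volume_le_of_forall_arc (by positivity) (by positivity) hαβ (fun x hx => hx.1.1)
    harc).trans (ENNReal.ofReal_le_ofReal ?_)
  have hl : 0 ≤ β - α := by linarith
  have e : ((β - α) / (ρ / ω) + 1) * (4 * ρ ^ 2 / ω) = 4 * (β - α + ρ / ω) * ρ := by
    field_simp
  rw [e]
  have : ρ / ω ≤ 1 := (div_le_self hρ.le hω).trans (by linarith)
  gcongr

/-- Measure of the set of points admitting a small nonzero integer form of height `2 ^ m`. -/
theorem volume_small_forms_le (h : UniformlyConvexOn f g α β m₀ M) (hαβ : α ≤ β) {κ m : ℕ} {θ : ℝ}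
    (hg : ∀ x ∈ Set.Icc α β, 1 + |g x| < 2 ^ κ) (hθ : 73 ≤ θ) (hθM : 2 * M ≤ θ) :
    volume {x ∈ Set.Icc α β | ∃ a b c : ℤ, (a ≠ 0 ∨ b ≠ 0 ∨ c ≠ 0) ∧ |(b : ℝ)| ≤ 2 ^ m ∧
      |(c : ℝ)| ≤ 2 ^ m ∧ |affineForm f a b c x| ≤ (1 / (2 ^ m * θ ^ 4)) ^ 2} ≤
    ENNReal.ofReal ((22 * (β - α + 3) + 12 * (κ + 1) * (β - α + 1) +
      18 * (β - α + 1) * (4 + 2 / m₀)) * ((m + 1) / θ ^ 2)) := by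
  have hm := h.m₀_pos
  have hM := h.M_pos
  have hl : 0 ≤ β - α := by linarith
  have hθ0 : 0 < θ := by linarith
  have hθ1 : 1 ≤ θ := by linarith
  set H : ℝ := 2 ^ m with hH
  have hH1 : 1 ≤ H := one_le_pow₀ (by norm_num)
  have hH0 : 0 < H := by linarith
  set R : ℝ := √H with hR
  have hR2 : R ^ 2 = H := Real.sq_sqrt hH0.le
  have hR1 : 1 ≤ R := Real.one_le_sqrt.2 hH1
  have hR0 : 0 < R := by linarith
  set ρ : ℝ := 1 / (H * θ ^ 4) with hρ
  have hρ0 : 0 < ρ := by positivity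
  have hθ4 : θ ≤ θ ^ 4 := le_self_pow₀ hθ1 (by norm_num)
  have hρθ : ρ ≤ 1 / θ := by
    rw [hρ]
    refine one_div_le_one_div_of_le hθ0 ?_
    nlinarith
  have hρ1 : 5 * ρ < 1 := by
    have : 1 / θ ≤ 1 / 73 := by gcongr
    linarith
  have hHρ : H * M * ρ ≤ 1 := by
    have e : H * M * ρ = M / θ ^ 4 := by rw [hρ]; field_simp
    rw [e, div_le_one (by positivity)]
    linarith
  set N₁ := nearRational (R / θ) (1 / (R * θ)) with hN₁
  set N₂ := nearRational (2 * H) (5 * ρ) with hN₂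
  set A : ℤ → ℕ → Set ℝ := fun c k => {x ∈ Set.Icc α β \ N₂ | ∃ a b : ℤ, |(b : ℝ)| ≤ H ∧
      |affineForm f a b c x| ≤ ρ ^ 2 ∧ 2 ^ k ≤ |affineFormDeriv g b c x| ∧
      |affineFormDeriv g b c x| ≤ 2 * 2 ^ k} with hA
  set B : ℕ → Set ℝ := fun j => {x ∈ Set.Icc α β \ N₁ | ∃ v : ℤ × ℤ × ℤ,
      IsPrimitiveTriple v ∧ (2 : ℝ) ^ j ≤ v.2.2 ∧ (v.2.2 : ℝ) ≤ 2 * 2 ^ j ∧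
      |affineForm f v.1 v.2.1 v.2.2 x| ≤ ρ ^ 2 ∧ |affineFormDeriv g v.2.1 v.2.2 x| ≤ 1} with hB
  have vN₁ : volume (Set.Icc α β ∩ N₁) ≤ ENNReal.ofReal (2 * (β - α + 3) / θ ^ 2) := by
    refine (volume_inter_nearRational_le hαβ (by positivity) (by positivity) ?_).trans_eq ?_
    · rw [div_le_one (by positivity)]; nlinarith
    · congr 1; field_simp
  have vN₂ : volume (Set.Icc α β ∩ N₂) ≤ ENNReal.ofReal (20 * (β - α + 3) / θ ^ 4) := by
    refine (volume_inter_nearRational_le hαβ (by positivity) (by positivity) hρ1.le).trans_eq ?_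
    congr 1; rw [hρ]; field_simp; norm_num
  have vA : volume (⋃ c ∈ Finset.Icc (-2 ^ m : ℤ) (2 ^ m), ⋃ k ∈ Finset.range (m + κ + 1), A c k) ≤
      ENNReal.ofReal ((2 * H + 1) * ((m + κ + 1) * (4 * (β - α + 1) * ρ))) := by
    refine (volume_biUnion_finset_le_card_mul _ _ fun c hc =>
      volume_biUnion_finset_le_card_mul (d := 4 * (β - α + 1) * ρ) _ _ fun k _ => ?_).trans_eq ?_
    · refine h.volume_forms_dyadic_deriv_le hαβ hρ0 hρ1 hHρ (one_le_pow₀ (by norm_num)) ?_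
      obtain ⟨h1, h2⟩ := Finset.mem_Icc.1 hc
      rw [hH, abs_le]
      exact ⟨by exact_mod_cast h1, by exact_mod_cast h2⟩
    · congr 2
      · rw [Int.card_Icc, ← Int.cast_natCast, Int.toNat_of_nonneg]
        · push_cast; rw [hH]; ring
        · have : (0 : ℤ) ≤ 2 ^ m := by positivity
          linarith
      · rw [Finset.card_range]; push_cast; ring
  have vB : volume (⋃ j ∈ Finset.range (m + 1), B j) ≤
      ENNReal.ofReal ((m + 1) * (18 * (β - α + 1) * (4 + 2 / m₀) / θ ^ 2)) := by
    refine (volume_biUnion_finset_le_card_mul _ _ fun j hj => ?_).trans_eq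
      (by rw [Finset.card_range]; push_cast; rfl)
    have hj' : (2 : ℝ) ^ j ≤ H :=
      pow_le_pow_right₀ (by norm_num) (Nat.lt_succ_iff.1 (Finset.mem_range.1 hj))
    have := h.volume_forms_small_deriv_le hαβ (R := R) (U := √(2 ^ j)) hθ hθM
      (Real.one_le_sqrt.2 (one_le_pow₀ (by norm_num))) (Real.sqrt_le_sqrt hj')
    rwa [hR2, Real.sq_sqrt (by positivity)] at this
  have hsub : {x ∈ Set.Icc α β | ∃ a b c : ℤ, (a ≠ 0 ∨ b ≠ 0 ∨ c ≠ 0) ∧ |(b : ℝ)| ≤ H ∧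
      |(c : ℝ)| ≤ H ∧ |affineForm f a b c x| ≤ ρ ^ 2} ⊆
      ((Set.Icc α β ∩ N₁) ∪ (Set.Icc α β ∩ N₂)) ∪
      ((⋃ c ∈ Finset.Icc (-2 ^ m : ℤ) (2 ^ m), ⋃ k ∈ Finset.range (m + κ + 1), A c k) ∪
        ⋃ j ∈ Finset.range (m + 1), B j) := by
    rintro x ⟨hxJ, a₀, b₀, c₀, hne, hb₀, hc₀, hF₀⟩
    by_cases hxN₁ : x ∈ N₁
    · exact Or.inl (Or.inl ⟨hxJ, hxN₁⟩)
    by_cases hxN₂ : x ∈ N₂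
    · exact Or.inl (Or.inr ⟨hxJ, hxN₂⟩)
    right
    obtain ⟨d, a, b, c, hd, rfl, rfl, rfl, hprim⟩ := exists_isPrimitiveTriple_mul hne
    have hd1 : (1 : ℝ) ≤ |(d : ℝ)| := by
      rw [abs_of_pos (by exact_mod_cast hd)]; exact_mod_cast hd
    have hcancel : ∀ {y z : ℝ}, |d * y| ≤ z → |y| ≤ z := fun {y z} hyz => by
      rw [abs_mul] at hyz
      nlinarith [abs_nonneg y]
    have hb : |(b : ℝ)| ≤ H := hcancel (by exact_mod_cast hb₀)
    have hc : |(c : ℝ)| ≤ H := hcancel (by exact_mod_cast hc₀)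
    have hF : |affineForm f a b c x| ≤ ρ ^ 2 := hcancel (by
      convert hF₀ using 2; unfold affineForm; push_cast; ring)
    rcases le_total 1 |affineFormDeriv g b c x| with h1 | h1
    · left
      obtain ⟨k, hk1, hk2⟩ := exists_nat_pow_near h1 (show (1 : ℝ) < 2 by norm_num)
      simp only [Set.mem_iUnion]
      refine ⟨c, ?_, k, ?_, ⟨hxJ, hxN₂⟩, a, b, hb, hF, hk1, by rw [pow_succ] at hk2; linarith⟩
      · obtain ⟨h2, h3⟩ := abs_le.1 hc
        rw [hH] at h2 h3
        rw [Finset.mem_Icc]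
        exact ⟨by exact_mod_cast h2, by exact_mod_cast h3⟩
      · have h2 : |affineFormDeriv g b c x| ≤ H * (1 + |g x|) := by
          unfold affineFormDeriv
          refine (abs_add_le _ _).trans ?_
          rw [abs_mul]
          nlinarith [abs_nonneg (g x)]
        have h3 : (2 : ℝ) ^ k < 2 ^ (m + κ) := by
          rw [pow_add, ← hH]
          have := hg x hxJ
          nlinarith
        rw [Finset.mem_range]
        have := (pow_lt_pow_iff_right₀ (by norm_num : (1 : ℝ) < 2)).1 h3
        omega
    · right
      have hpos : ∀ a b c : ℤ, 0 < c → (c : ℝ) ≤ H → IsPrimitiveTriple (a, b, c) →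
          |affineForm f a b c x| ≤ ρ ^ 2 → |affineFormDeriv g b c x| ≤ 1 →
          x ∈ ⋃ j ∈ Finset.range (m + 1), B j := by
        intro a b c hc0 hcH hprim hF h1
        have hc1 : (1 : ℝ) ≤ c := by exact_mod_cast hc0
        obtain ⟨j, hj1, hj2⟩ := exists_nat_pow_near hc1 (show (1 : ℝ) < 2 by norm_num)
        simp only [Set.mem_iUnion]
        refine ⟨j, ?_, ⟨hxJ, hxN₁⟩, (a, b, c), hprim, hj1, ?_, hF, h1⟩
        swap
        · rw [pow_succ] at hj2
          simp only
          linarith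
        rw [Finset.mem_range]
        have := (pow_le_pow_iff_right₀ (by norm_num : (1 : ℝ) < 2)).1 (hj1.trans hcH)
        omega
      rcases lt_trichotomy c 0 with hc0 | hc0 | hc0
      · refine hpos (-a) (-b) (-c) (by omega) (by push_cast; exact (neg_le_abs _).trans hc) ?_ ?_ ?_
        · obtain ⟨l, i, n, e⟩ := hprim
          exact ⟨-l, -i, -n, by simp only at e ⊢; linarith⟩
        · rw [← abs_neg]; convert hF using 2; unfold affineForm; push_cast; ring
        · have e : affineFormDeriv g (-b) (-c) x = -affineFormDeriv g b c x := by
            unfold affineFormDeriv; push_cast; ring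
          rwa [e, abs_neg]
      · exfalso
        subst hc0
        have hρ2 : ρ ^ 2 ≤ 5 * ρ := by nlinarith
        have hF0 : |b * x + a| ≤ 5 * ρ := by
          have e : affineForm f a b 0 x = b * x + a := by
            unfold affineForm; push_cast; ring
          exact e ▸ hF.trans hρ2
        have hb1 : |(b : ℝ)| ≤ 1 := by
          have e : affineFormDeriv g b 0 x = b := by unfold affineFormDeriv; push_cast; ring
          exact e ▸ h1
        obtain ⟨hb2, hb3⟩ := abs_le.1 hb1
        rcases lt_trichotomy b 0 with hb0 | hb0 | hb0
        · refine hxN₂ ⟨-b, a, by omega, by push_cast; linarith, ?_⟩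
          rw [← abs_neg]; convert hF0 using 2; push_cast; ring
        · obtain ⟨l, i, n, e⟩ := hprim
          rw [hb0, Int.cast_zero, zero_mul, zero_add] at hF0
          have ha : |a| < 1 := by exact_mod_cast hF0.trans_lt hρ1
          simp [hb0, Int.abs_lt_one_iff.1 ha] at e
        · refine hxN₂ ⟨b, -a, hb0, by linarith, ?_⟩
          convert hF0 using 2; push_cast; ring
      · exact hpos a b c hc0 ((le_abs_self _).trans hc) hprim hF h1
  have hm1 : (0 : ℝ) ≤ m := Nat.cast_nonneg m
  have hκ1 : (0 : ℝ) ≤ κ := Nat.cast_nonneg κ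
  refine (volume_union_le_ofReal_add (by positivity) (by positivity) hsub
    (volume_union_le_ofReal_add (by positivity) (by positivity) subset_rfl vN₁ vN₂)
    (volume_union_le_ofReal_add (by positivity) (by positivity) subset_rfl vA vB)).trans
    (ENNReal.ofReal_le_ofReal ?_)
  have hθ2 : 1 / θ ^ 4 ≤ 1 / θ ^ 2 :=
    one_div_le_one_div_of_le (by positivity) (pow_le_pow_right₀ hθ1 (by norm_num))
  have t1 : 2 * (β - α + 3) / θ ^ 2 + 20 * (β - α + 3) / θ ^ 4 ≤
      22 * (β - α + 3) * ((m + 1) / θ ^ 2) := by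
    have e1 : 2 * (β - α + 3) / θ ^ 2 + 20 * (β - α + 3) / θ ^ 4 =
      2 * (β - α + 3) * (1 / θ ^ 2) + 20 * (β - α + 3) * (1 / θ ^ 4) := by ring
    have e2 : (1 : ℝ) / θ ^ 2 ≤ (m + 1) / θ ^ 2 := by gcongr; linarith
    rw [e1]
    nlinarith
  have t2 : (2 * H + 1) * ((m + κ + 1) * (4 * (β - α + 1) * ρ)) ≤
      12 * (κ + 1) * (β - α + 1) * ((m + 1) / θ ^ 2) := by
    calc (2 * H + 1) * ((m + κ + 1) * (4 * (β - α + 1) * ρ))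
        ≤ (3 * H) * (((m + 1) * (κ + 1)) * (4 * (β - α + 1) * ρ)) := by
          gcongr
          · linarith
          · nlinarith
      _ = 12 * (κ + 1) * (β - α + 1) * (m + 1) * (1 / θ ^ 4) := by rw [hρ]; field_simp; norm_num
      _ ≤ 12 * (κ + 1) * (β - α + 1) * (m + 1) * (1 / θ ^ 2) := by gcongr
      _ = _ := by ring
  have t3 : (m + 1) * (18 * (β - α + 1) * (4 + 2 / m₀) / θ ^ 2) =
      18 * (β - α + 1) * (4 + 2 / m₀) * ((m + 1) / θ ^ 2) := by ring
  rw [t3]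
  linarith

end UniformlyConvexOn

theorem exists_int_abs_sub_lt_of_nint_lt {x r : ℝ} (h : nint x < r) : ∃ z : ℤ, |x - z| < r :=
  exists_lt_of_ciInf_lt h

/-- A simultaneous approximation yields a small integer form, by the pigeonhole principle. -/
theorem exists_affineForm_le_of_simultaneous {f : ℝ → ℝ} {x η : ℝ} {q B : ℕ} (hq : 0 < q)
    (hqB : q < B * B) {p₁ p₂ : ℤ} (h1 : |q * x - p₁| ≤ η) (h2 : |q * f x - p₂| ≤ η) :
    ∃ a b c : ℤ, (a ≠ 0 ∨ b ≠ 0 ∨ c ≠ 0) ∧ |(b : ℝ)| ≤ B ∧ |(c : ℝ)| ≤ B ∧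
      |affineForm f a b c x| ≤ 2 * B * η / q := by
  have hq' : (0 : ℝ) < q := by exact_mod_cast hq
  obtain ⟨⟨i, j⟩, hij, ⟨k, l⟩, hkl, hne, heq⟩ := Finset.exists_ne_map_eq_of_card_lt_of_maps_to
    (s := Finset.range B ×ˢ Finset.range B) (t := Finset.Ico (0 : ℤ) q)
    (f := fun v : ℕ × ℕ => (v.1 * p₁ + v.2 * p₂) % (q : ℤ)) (by simpa using hqB)
    (fun v _ => by
      simp only [Finset.coe_Ico, Set.mem_Ico]
      exact ⟨Int.emod_nonneg _ (by omega), Int.emod_lt_of_pos _ (by omega)⟩)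
  simp only [Finset.mem_product, Finset.mem_range] at hij hkl
  obtain ⟨e, he⟩ := Int.ModEq.dvd heq
  have he' : (k * p₁ + l * p₂ : ℝ) - (i * p₁ + j * p₂) = q * e := by exact_mod_cast he
  have abs_natCast_sub_le : ∀ m n : ℕ, m < B → n < B → |((m : ℝ) - n)| ≤ B := by
    intro m n hm hn
    have hm' : (m : ℝ) < B := by exact_mod_cast hm
    have hn' : (n : ℝ) < B := by exact_mod_cast hn
    rw [abs_le]
    constructor <;> linarith [m.cast_nonneg (α := ℝ), n.cast_nonneg (α := ℝ)]
  have hb := abs_natCast_sub_le k i hkl.1 hij.1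
  have hc := abs_natCast_sub_le l j hkl.2 hij.2
  refine ⟨-e, k - i, l - j, ?_, by push_cast; exact hb, by push_cast; exact hc, ?_⟩
  · right
    by_contra! h
    exact hne (by rw [Prod.mk.injEq]; omega)
  · have hF : affineForm f (-e) (k - i) (l - j) x =
        (((k : ℝ) - i) * (q * x - p₁) + (l - j) * (q * f x - p₂)) / q := by
      rw [eq_div_iff hq'.ne', affineForm]
      push_cast
      linear_combination he'
    rw [hF, abs_div, abs_of_pos hq']
    gcongr
    refine (abs_add_le _ _).trans ?_
    rw [abs_mul, abs_mul]
    calc _ ≤ (B : ℝ) * η + B * η := by gcongr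
      _ = _ := by ring

theorem UniformlyConvexOn.volume_simultaneous_eq_zero {f g : ℝ → ℝ} {α β m₀ M τ : ℝ}
    (h : UniformlyConvexOn f g α β m₀ M) (hαβ : α ≤ β) (hτ : 1 / 2 < τ) :
    volume {x ∈ Set.Icc α β | {q : ℕ | 0 < q ∧ nint (q * x) < (q : ℝ) ^ (-τ) ∧
      nint (q * f x) < (q : ℝ) ^ (-τ)}.Infinite} = 0 := by
  obtain ⟨κ, hκ⟩ : ∃ κ : ℕ, 1 + (|g α| + M * (β - α)) < 2 ^ κ :=
    pow_unbounded_of_one_lt _ (by norm_num)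
  have hg : ∀ x ∈ Set.Icc α β, 1 + |g x| < 2 ^ κ := by
    intro x hx
    have h1 := h.lower α ⟨le_rfl, hαβ⟩ x hx hx.1
    have h2 := h.upper α ⟨le_rfl, hαβ⟩ x hx hx.1
    have h3 : |g x - g α| ≤ M * (β - α) := by
      rw [abs_of_nonneg (by nlinarith [h.m₀_pos, hx.1])]
      nlinarith [h.M_pos, hx.2]
    linarith [abs_sub_abs_le_abs_sub (g x) (g α)]
  set t : ℝ := 2 ^ ((2 * τ - 1) / 16) with ht
  have ht1 : 1 < t := Real.one_lt_rpow (by norm_num) (by linarith)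
  have ht0 : 0 < t := by linarith
  have ht16 : (2 : ℝ) ^ (2 * τ) = 2 * t ^ 16 := by
    have h1 : 2 * τ = 1 + (2 * τ - 1) / 16 * ((16 : ℕ) : ℝ) := by push_cast; ring
    rw [ht, h1, Real.rpow_add (by norm_num), Real.rpow_one, Real.rpow_mul (by norm_num),
      Real.rpow_natCast, ← h1]
  obtain ⟨n₀, hn₀⟩ := pow_unbounded_of_one_lt (max (max 73 (2 * M)) (2 * 4 ^ (1 + τ))) ht1
  set K : ℝ := 22 * (β - α + 3) + 12 * (κ + 1) * (β - α + 1) +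
      18 * (β - α + 1) * (4 + 2 / m₀) with hK
  set P : ℕ → ℝ → Prop := fun n x => n₀ ≤ n ∧ x ∈ Set.Icc α β ∧
    ∃ a b c : ℤ, (a ≠ 0 ∨ b ≠ 0 ∨ c ≠ 0) ∧ |(b : ℝ)| ≤ 2 ^ n ∧
      |(c : ℝ)| ≤ 2 ^ n ∧ |affineForm f a b c x| ≤ (1 / (2 ^ n * (t ^ n) ^ 4)) ^ 2 with hP
  have hbound : ∀ n, volume {x | P n x} ≤ ENNReal.ofReal (K * ((n + 1) / (t ^ n) ^ 2)) := by
    intro n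
    by_cases hn : n₀ ≤ n
    · have hle := (max_le_iff.1 (hn₀.le.trans (pow_le_pow_right₀ ht1.le hn))).1
      refine (measure_mono ?_).trans
        (h.volume_small_forms_le hαβ hg (max_le_iff.1 hle).1 (max_le_iff.1 hle).2)
      exact fun x hx => hx.2
    · have : {x | P n x} = ∅ := Set.eq_empty_of_forall_notMem fun x hx => hn hx.1
      rw [this, measure_empty]
      exact zero_le
  have hsum : Summable fun n : ℕ => K * (((n : ℝ) + 1) / (t ^ n) ^ 2) := by
    have hr : ‖(1 / t ^ 2 : ℝ)‖ < 1 := by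
      rw [Real.norm_of_nonneg (by positivity), div_lt_one (by positivity)]
      exact one_lt_pow₀ ht1 (by norm_num)
    have h1 := (summable_pow_mul_geometric_of_norm_lt_one 1 hr).add
      (summable_geometric_of_norm_lt_one hr)
    refine (h1.congr fun n => ?_).mul_left K
    rw [div_pow, one_pow, ← pow_mul, ← pow_mul, mul_comm 2 n]
    ring
  have hBC : volume {x | ∃ᶠ n in Filter.atTop, P n x} = 0 :=
    measure_setOfPred_frequently_eq_zero
      (ne_top_of_le_ne_top hsum.tsum_ofReal_ne_top (ENNReal.tsum_le_tsum hbound))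
  refine measure_mono_null ?_ hBC
  rintro x ⟨hxJ, hinf⟩
  refine Filter.frequently_atTop.2 fun N => ?_
  obtain ⟨q, ⟨hq0, hq1, hq2⟩, hqN⟩ := hinf.exists_gt (4 ^ (max N n₀))
  obtain ⟨m, hm1, hm2⟩ := exists_nat_pow_near (show (1 : ℝ) ≤ q by exact_mod_cast hq0)
    (show (1 : ℝ) < 4 by norm_num)
  have hmN : max N n₀ ≤ m := by
    have h1 : (4 : ℝ) ^ (max N n₀) < 4 ^ (m + 1) := lt_trans (by exact_mod_cast hqN) hm2
    have := (pow_lt_pow_iff_right₀ (by norm_num : (1 : ℝ) < 4)).1 h1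
    omega
  have hNm := max_le_iff.1 hmN
  obtain ⟨p₁, hp₁⟩ := exists_int_abs_sub_lt_of_nint_lt hq1
  obtain ⟨p₂, hp₂⟩ := exists_int_abs_sub_lt_of_nint_lt hq2
  have hqB : q < 2 ^ (m + 1) * 2 ^ (m + 1) := by
    rw [← mul_pow]
    exact_mod_cast hm2
  obtain ⟨a, b, c, hne, hb, hc, hF⟩ :=
    exists_affineForm_le_of_simultaneous hq0 hqB hp₁.le hp₂.le
  refine ⟨m + 1, by omega, by omega, hxJ, a, b, c, hne, by exact_mod_cast hb,
    by exact_mod_cast hc, hF.trans ?_⟩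
  have hq' : (0 : ℝ) < q := by exact_mod_cast hq0
  have hlarge : 2 * (4 : ℝ) ^ (1 + τ) ≤ t ^ (m + 1) :=
    (max_le_iff.1 (hn₀.le.trans (pow_le_pow_right₀ ht1.le (by omega)))).2
  have hlarge' : 2 * (4 : ℝ) ^ (1 + τ) ≤ (t ^ (m + 1)) ^ 8 :=
    hlarge.trans (le_self_pow₀ (one_le_pow₀ ht1.le) (by norm_num))
  have hqpow : (4 ^ (m + 1) / 4 : ℝ) ^ (1 + τ) ≤ (q : ℝ) ^ (1 + τ) := by
    refine Real.rpow_le_rpow (by positivity) ?_ (by linarith)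
    rw [pow_succ]
    linarith
  have h4 : ((4 : ℝ) ^ (m + 1)) ^ (1 + τ) = ((2 : ℝ) ^ (m + 1)) ^ 3 * (t ^ (m + 1)) ^ 16 := by
    rw [← Real.rpow_pow_comm (by norm_num)]
    have : (4 : ℝ) ^ (1 + τ) = 2 ^ 3 * t ^ 16 := by
      rw [show (4 : ℝ) = 2 ^ (2 : ℝ) by norm_num, ← Real.rpow_mul (by norm_num), mul_add,
        Real.rpow_add (by norm_num), ht16]
      norm_num
      ring
    rw [this, mul_pow, pow_right_comm, pow_right_comm t]
  have e : 2 * ((2 ^ (m + 1) : ℕ) : ℝ) * (q : ℝ) ^ (-τ) / q =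
      2 * 2 ^ (m + 1) / (q : ℝ) ^ (1 + τ) := by
    rw [Real.rpow_neg hq'.le, Real.rpow_add hq', Real.rpow_one]
    push_cast
    field_simp
  rw [e]
  rw [Real.div_rpow (by positivity) (by norm_num), h4] at hqpow
  have hpos : 0 < (t ^ (m + 1)) ^ 8 := by positivity
  set Y : ℝ := 2 ^ (m + 1) with hY
  set Z : ℝ := t ^ (m + 1) with hZ
  have hY0 : 0 < Y := by positivity
  have hZ0 : 0 < Z := by positivity
  calc 2 * Y / (q : ℝ) ^ (1 + τ) ≤ 2 * Y / (Y ^ 3 * Z ^ 16 / 4 ^ (1 + τ)) := by gcongr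
    _ = 2 * 4 ^ (1 + τ) / (Y ^ 2 * Z ^ 16) := by field_simp
    _ ≤ Z ^ 8 / (Y ^ 2 * Z ^ 16) := by gcongr
    _ = _ := by field_simp

/-- A `C³` function with positive second derivative at `x₀` is uniformly convex near `x₀`. -/
theorem exists_uniformlyConvexOn {I : Set ℝ} (hI : IsOpen I) {f : ℝ → ℝ}
    (hf : ContDiffOn ℝ 3 f I) {x₀ : ℝ} (hx₀ : x₀ ∈ I) (hpos : 0 < deriv (deriv f) x₀) :
    ∃ η m₀ M : ℝ, 0 < η ∧ UniformlyConvexOn f (deriv f) (x₀ - η) (x₀ + η) m₀ M := by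
  have hf1 : ContDiffOn ℝ 2 (deriv f) I := hf.deriv_of_isOpen hI (by norm_num)
  have hf2 : ContDiffOn ℝ 1 (deriv (deriv f)) I := hf1.deriv_of_isOpen hI (by norm_num)
  have hcont : ContinuousAt (deriv (deriv f)) x₀ := hf2.continuousOn.continuousAt (hI.mem_nhds hx₀)
  set s := deriv (deriv f) x₀ with hs
  have hev : ∀ᶠ x in nhds x₀, x ∈ I ∧ deriv (deriv f) x ∈ Set.Ioo (s / 2) (2 * s) :=
    (hI.eventually_mem hx₀).and (hcont.eventually_mem (Ioo_mem_nhds (by linarith) (by linarith)))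
  obtain ⟨η, hη, hball⟩ := Metric.nhds_basis_closedBall.eventually_iff.1 hev
  rw [Real.closedBall_eq_Icc] at hball
  have hd : ∀ x ∈ Set.Icc (x₀ - η) (x₀ + η), HasDerivAt (deriv f) (deriv (deriv f) x) x :=
    fun x hx => ((hf1.differentiableOn (by norm_num)).differentiableAt
      (hI.mem_nhds (hball hx).1)).hasDerivAt
  refine ⟨η, s / 2, 2 * s, hη, fun x hx => ?_, ?_, ?_, by positivity, by positivity⟩
  · exact ((hf.differentiableOn (by norm_num)).differentiableAt
      (hI.mem_nhds (hball hx).1)).hasDerivAt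
  · refine (convex_Icc _ _).mul_sub_le_image_sub_of_le_deriv
      (fun x hx => (hd x hx).continuousAt.continuousWithinAt)
      (fun x hx => (hd x (interior_subset hx)).differentiableAt.differentiableWithinAt)
      fun x hx => (hball (interior_subset hx)).2.1.le
  · refine (convex_Icc _ _).image_sub_le_mul_sub_of_deriv_le
      (fun x hx => (hd x hx).continuousAt.continuousWithinAt)
      (fun x hx => (hd x (interior_subset hx)).differentiableAt.differentiableWithinAt)
      fun x hx => (hball (interior_subset hx)).2.2.le

theorem nint_neg (x : ℝ) : nint (-x) = nint x := by
  unfold nint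
  refine (Equiv.neg ℤ).iInf_congr fun z => ?_
  rw [Equiv.neg_apply, Int.cast_neg, ← abs_neg]
  congr 1
  ring

theorem volume_simultaneous_eq_zero_of_contDiffOn {I : Set ℝ} (hI : IsOpen I) {f : ℝ → ℝ}
    (hf : ContDiffOn ℝ 3 f I) (hf2 : ∀ x ∈ I, iteratedDeriv 2 f x ≠ 0) {τ : ℝ} (hτ : 1 / 2 < τ) :
    volume {x : ℝ | x ∈ I ∧ {q : ℕ | 0 < q ∧ nint (q * x) < (q : ℝ) ^ (-τ) ∧
      nint (q * f x) < (q : ℝ) ^ (-τ)}.Infinite} = 0 := by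
  refine measure_null_of_locally_null _ fun x₀ hx₀ => ?_
  have key : ∀ F : ℝ → ℝ, ContDiffOn ℝ 3 F I → 0 < deriv (deriv F) x₀ →
      (∀ x, ∀ q : ℕ, nint (q * F x) = nint (q * f x)) →
      ∃ u ∈ nhdsWithin x₀ {x : ℝ | x ∈ I ∧ {q : ℕ | 0 < q ∧ nint (q * x) < (q : ℝ) ^ (-τ) ∧
        nint (q * f x) < (q : ℝ) ^ (-τ)}.Infinite}, volume u = 0 := by
    intro F hF hpos hFf
    obtain ⟨η, m₀, M, hη, hconv⟩ := exists_uniformlyConvexOn hI hF hx₀.1 hpos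
    refine ⟨_, ?_, hconv.volume_simultaneous_eq_zero (by linarith) hτ⟩
    simp only [hFf]
    filter_upwards [self_mem_nhdsWithin, mem_nhdsWithin_of_mem_nhds
      (Icc_mem_nhds (show x₀ - η < x₀ by linarith) (show x₀ < x₀ + η by linarith))] with x h1 h2
    exact ⟨h2, h1.2⟩
  have h2 := hf2 x₀ hx₀.1
  rw [iteratedDeriv_succ, iteratedDeriv_one] at h2
  rcases h2.lt_or_gt with hlt | hgt
  · refine key (fun x => -f x) hf.neg ?_ fun x q => by rw [mul_neg, nint_neg]
    rw [deriv.fun_neg', deriv.fun_neg]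
    linarith
  · exact key f hf hgt fun _ _ => rfl

theorem lipschitzOnWith_graph {I : Set ℝ} {f : ℝ → ℝ} {C : NNReal} (hf : LipschitzOnWith C f I) :
    LipschitzOnWith (1 + C) (fun x => (!₂[x, f x] : EuclideanSpace ℝ (Fin 2))) I := by
  refine LipschitzOnWith.of_dist_le_mul fun x hx y hy => ?_
  have h := hf.dist_le_mul x hx y hy
  rw [EuclideanSpace.dist_eq, Fin.sum_univ_two]
  simp only [Matrix.cons_val_zero, Matrix.cons_val_one]
  refine Real.sqrt_le_iff.2 ⟨by positivity, ?_⟩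
  push_cast
  nlinarith [dist_nonneg (x := x) (y := y), dist_nonneg (x := f x) (y := f y), C.2,
    mul_nonneg C.2 (dist_nonneg (x := x) (y := y))]

/-- **Schmidt's theorem**: for `τ > 1/2` and `ψ(q) = q^{-τ}`, the set
`C_f ∩ S₂(ψ, ψ)` is null: `ℋ¹(C_f ∩ S₂(ψ, ψ)) = 0`; equivalently the set of `x ∈ I`
with infinitely many `q` satisfying `‖qx‖ < q^{-τ}` and `‖q f(x)‖ < q^{-τ}` has
Lebesgue measure zero. -/
theorem schmidt_theorem
    (I : Set ℝ) (hIopen : IsOpen I) (hIconn : I.OrdConnected)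
    (f : ℝ → ℝ) (hf : ContDiffOn ℝ 3 f I)
    (c₁ c₂ : ℝ) (hc₂pos : 0 < c₂) (hc₂₁ : c₂ < c₁)
    (hderiv : ∀ x ∈ I, c₂ < deriv f x ∧ deriv f x < c₁)
    (hderiv2 : ∀ x ∈ I, iteratedDeriv 2 f x ≠ 0)
    (τ : ℝ) (hτ : 1 / 2 < τ) :
    μH[(1 : ℝ)] ({ p : EuclideanSpace ℝ (Fin 2) | p 0 ∈ I ∧ p 1 = f (p 0) } ∩
        S2 (fun q => (q : ℝ) ^ (-τ)) (fun q => (q : ℝ) ^ (-τ))) = 0 ∧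
    volume {x : ℝ | x ∈ I ∧
      {q : ℕ | 0 < q ∧ nint (q * x) < (q : ℝ) ^ (-τ) ∧
        nint (q * f x) < (q : ℝ) ^ (-τ)}.Infinite} = 0 := by
  have hvol := volume_simultaneous_eq_zero_of_contDiffOn hIopen hf hderiv2 hτ
  refine ⟨?_, hvol⟩
  set A := {x : ℝ | x ∈ I ∧ {q : ℕ | 0 < q ∧ nint (q * x) < (q : ℝ) ^ (-τ) ∧
    nint (q * f x) < (q : ℝ) ^ (-τ)}.Infinite} with hA
  have hfLip : LipschitzOnWith c₁.toNNReal f I := by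
    refine hIconn.convex.lipschitzOnWith_of_nnnorm_deriv_le (fun x hx =>
      (hf.differentiableOn (by norm_num)).differentiableAt (hIopen.mem_nhds hx)) fun x hx => ?_
    obtain ⟨h1, h2⟩ := hderiv x hx
    rw [← NNReal.coe_le_coe, coe_nnnorm, Real.coe_toNNReal _ (by linarith),
      Real.norm_of_nonneg (by linarith)]
    exact h2.le
  have hLip := (lipschitzOnWith_graph hfLip).mono (fun x (hx : x ∈ A) => hx.1)
  have himage := hLip.hausdorffMeasure_image_le (d := 1) zero_le_one
  rw [hausdorffMeasure_real, hvol, mul_zero] at himage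
  refine measure_mono_null ?_ (le_antisymm himage zero_le)
  rintro p ⟨⟨hp0, hp1⟩, hp⟩
  refine ⟨p 0, ⟨hp0, ?_⟩, ?_⟩
  · rw [← hp1]; exact hp
  · ext i
    fin_cases i
    · rfl
    · exact hp1.symm
end
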